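/- arXiv:1711.08555 — 4 statements merged into one kernel-verified Lean document; each statement's English description precedes it below -/
import Mathlib

section
/- Let m ≥ 2 and let T be the perfect unrooted m-ary tree of diameter D. Then for every even integer t with 1 ≤ t ≤ D, the number of paths of length t in T equals (1/2)(m+1) · m^(t/2 − 1) · (V(D) − V(t−1)), where V(d) is the number of vertices in the perfect unrooted m-ary tree of diameter d. -/
open SimpleGraph Finset

/-- `IsPerfectUnrootedMary m d H` says that `H` is the perfect unrooted `m`-ary tree of
diameter `d`: a tree in which every vertex has degree `1` or `m + 1`, whose maximum
distance between two vertices is `d`, and in which every degree-`1` vertex is at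
distance `d` from some other vertex.  (For `d = 0` the degree condition is dropped,
so that the one-vertex tree is the perfect tree of diameter `0`.) -/
def IsPerfectUnrootedMary (m d : ℕ) {W : Type} [Fintype W] (H : SimpleGraph W)
    [DecidableRel H.Adj] : Prop :=
  H.IsTree ∧
    (0 < d → ∀ v : W, H.degree v = 1 ∨ H.degree v = m + 1) ∧
    (∀ u v : W, H.dist u v ≤ d) ∧
    (∃ u v : W, H.dist u v = d) ∧
    (∀ v : W, H.degree v = 1 → ∃ u : W, H.dist u v = d)

/-- The number of paths of length `t` in `H`, i.e. the number of unordered pairs of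
vertices at distance exactly `t` from each other. -/
noncomputable def pathCount {W : Type} [Fintype W] [DecidableEq W] (H : SimpleGraph W) (t : ℕ) : ℕ :=
  (Finset.univ.filter fun p : Sym2 W => ∃ u v : W, p = s(u, v) ∧ H.dist u v = t).card

set_option linter.unusedSectionVars false

section TreeFacts

variable {W : Type} {G : SimpleGraph W}

lemma tr_step (hG : G.IsTree) (u : W) {x y : W} (h : G.Adj x y) :
    G.dist u x = G.dist u y + 1 ∨ G.dist u y = G.dist u x + 1 :=
  hG.dist_eq_dist_add_one_of_adj u h

lemma tr_parent (hG : G.IsTree) {u x : W} (h : u ≠ x) :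
    ∃ p, G.Adj x p ∧ G.dist u x = G.dist u p + 1 := by
  obtain ⟨q, hq⟩ := hG.connected.exists_walk_length_eq_dist x u
  cases q with
  | nil => exact absurd rfl h
  | @cons _ b _ hab r =>
    refine ⟨b, hab, ?_⟩
    have h1 := SimpleGraph.dist_le r
    rw [SimpleGraph.Walk.length_cons] at hq
    rcases tr_step hG u hab with h2 | h2
    · exact h2
    · rw [SimpleGraph.dist_comm] at h1 hq
      rw [SimpleGraph.dist_comm] at hq
      have h3 : G.dist x u = G.dist u x := SimpleGraph.dist_comm
      omega

lemma tr_parent_unique (hG : G.IsTree) {u x y z : W} (hy : G.Adj x y) (hz : G.Adj x z)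
    (hy' : G.dist u x = G.dist u y + 1) (hz' : G.dist u x = G.dist u z + 1) : y = z := by
  obtain ⟨p, hp⟩ := hG.connected.exists_walk_length_eq_dist u y
  obtain ⟨q, hq⟩ := hG.connected.exists_walk_length_eq_dist u z
  have h1 : (p.concat hy.symm).IsPath :=
    SimpleGraph.Walk.isPath_of_length_eq_dist _ (by rw [SimpleGraph.Walk.length_concat]; omega)
  have h2 : (q.concat hz.symm).IsPath :=
    SimpleGraph.Walk.isPath_of_length_eq_dist _ (by rw [SimpleGraph.Walk.length_concat]; omega)
  have h3 := (hG.existsUnique_path u x).unique h1 h2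
  have h4 := congrArg SimpleGraph.Walk.penultimate h3
  simpa using h4

/-- Concatenating geodesics through an edge. -/
lemma tr_concat (hG : G.IsTree) (u v : W) : ∀ (n : ℕ) (x y : W), G.dist v y = n → G.Adj x y →
    G.dist u y = G.dist u x + 1 → G.dist v x = G.dist v y + 1 →
    G.dist u v = G.dist u x + 1 + G.dist v y := by
  intro n
  induction n with
  | zero =>
    intro x y h0 hxy h1 h2
    have : v = y := (hG.connected.dist_eq_zero_iff).1 h0
    subst this
    simp [h1]
  | succ n ih =>
    intro x y h0 hxy h1 h2
    have hne : v ≠ y := by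
      rintro rfl
      simp at h0
    obtain ⟨z, hyz, hz⟩ := tr_parent hG hne
    have h3 : G.dist u z = G.dist u y + 1 := by
      rcases tr_step hG u hyz with h | h
      · have : x = z := tr_parent_unique hG hxy.symm hyz h1 h
        subst this
        omega
      · exact h
    have := ih y z (by omega) hyz h3 hz
    omega

lemma tr_median (hG : G.IsTree) (u v : W) : ∀ (n : ℕ) (x : W), G.dist u x = n →
    ∃ w, G.dist u v = G.dist u w + G.dist v w ∧ G.dist u x = G.dist u w + G.dist x w ∧
      G.dist v x = G.dist v w + G.dist x w := by
  intro n
  induction n with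
  | zero =>
    intro x h0
    have : u = x := (hG.connected.dist_eq_zero_iff).1 h0
    subst this
    exact ⟨u, by simp [SimpleGraph.dist_comm]⟩
  | succ n ih =>
    intro x h0
    have hne : u ≠ x := by
      rintro rfl
      simp at h0
    obtain ⟨z, hxz, hz⟩ := tr_parent hG hne
    rcases tr_step hG v hxz with h | h
    · obtain ⟨w, h1, h2, h3⟩ := ih z (by omega)
      refine ⟨w, h1, ?_⟩
      have h4 := tr_step hG w hxz
      have h5 : G.dist u x ≤ G.dist u w + G.dist w x := hG.connected.dist_triangle
      rw [SimpleGraph.dist_comm (u := x), SimpleGraph.dist_comm (u := z)] at *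
      omega
    · have := tr_concat hG u v _ z x rfl hxz.symm hz h
      exact ⟨x, by omega, by simp, by simp⟩

lemma tr_split (hG : G.IsTree) (u v w y : W) (h : G.dist u v = G.dist u w + G.dist v w) :
    G.dist u y = G.dist u w + G.dist y w ∨ G.dist v y = G.dist v w + G.dist y w := by
  by_cases hyw : y = w
  · subst hyw
    simp
  obtain ⟨z, hwz, hz⟩ := tr_parent hG hyw
  rcases tr_step hG u hwz with h1 | h1
  · right
    have h2 : G.dist v z = G.dist v w + 1 := by
      rcases tr_step hG v hwz with h2 | h2
      · have h3 : G.dist u v ≤ G.dist u z + G.dist z v := hG.connected.dist_triangle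
        rw [SimpleGraph.dist_comm (u := z)] at h3
        omega
      · exact h2
    have := tr_concat hG v y _ w z rfl hwz h2 hz
    omega
  · left
    have := tr_concat hG u y _ w z rfl hwz h1 hz
    omega

lemma tr_fourpoint (hG : G.IsTree) (u v x y : W) :
    G.dist x y + G.dist u v ≤ G.dist v x + G.dist u y ∨
      G.dist x y + G.dist u v ≤ G.dist u x + G.dist v y := by
  obtain ⟨w, h1, h2, h3⟩ := tr_median hG u v _ x rfl
  have h4 : G.dist x y ≤ G.dist x w + G.dist w y := hG.connected.dist_triangle
  rw [SimpleGraph.dist_comm (u := w)] at h4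
  rcases tr_split hG u v w y h1 with h | h <;> omega

end TreeFacts

section Counting

variable {W : Type} [Fintype W] [DecidableEq W] {G : SimpleGraph W} [DecidableRel G.Adj]

lemma cnt_mul (A B : Finset W) (k : ℕ) (h1 : ∀ x ∈ A, #{y ∈ B | G.Adj x y} = k)
    (h2 : ∀ y ∈ B, #{x ∈ A | G.Adj x y} = 1) : #B = k * #A := by
  have := Finset.card_mul_eq_card_mul (r := G.Adj) (s := A) (t := B) (m := k) (n := 1) h1 h2
  rw [mul_one] at this
  rw [← this, mul_comm]

lemma deg_ne_one {x y z : W} (hy : G.Adj x y) (hz : G.Adj x z) (h : y ≠ z) : G.degree x ≠ 1 := by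
  intro h1
  obtain ⟨w, _, hw⟩ := G.degree_eq_one_iff_existsUnique_adj.1 h1
  exact h ((hw y hy).trans (hw z hz).symm)

lemma deg_max (hG : G.IsTree) {d : ℕ} (hd : 0 < d) {u x : W} (hmax : ∀ y, G.dist u y ≤ d)
    (hx : G.dist u x = d) : G.degree x = 1 := by
  have hne : u ≠ x := by
    rintro rfl
    simp at hx
    omega
  obtain ⟨p, hxp, hp⟩ := tr_parent hG hne
  refine G.degree_eq_one_iff_existsUnique_adj.2 ⟨p, hxp, ?_⟩
  intro y hy
  rcases tr_step hG u hy with h | h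
  · exact tr_parent_unique hG hy hxp h hp
  · have := hmax y
    omega

lemma sphere_step {m D : ℕ} (hP : IsPerfectUnrootedMary m D G) (hD : 0 < D) (u : W) {t : ℕ}
    (ht : 1 ≤ t) :
    #{x | G.dist u x = t + 1} = m * #{x | G.dist u x = t ∧ G.degree x ≠ 1} := by
  obtain ⟨hG, hdeg, -, -, -⟩ := hP
  refine cnt_mul (G := G) _ _ m ?_ ?_
  · intro x hx
    simp only [mem_filter, mem_univ, true_and] at hx
    have hne : u ≠ x := by
      rintro rfl
      simp at hx
      omega
    obtain ⟨p, hxp, hp⟩ := tr_parent hG hne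
    have : ({y ∈ ({x | G.dist u x = t + 1} : Finset W) | G.Adj x y} : Finset W)
        = (G.neighborFinset x).erase p := by
      ext y
      simp only [mem_filter, mem_univ, true_and, mem_erase, mem_neighborFinset]
      constructor
      · rintro ⟨h1, h2⟩
        refine ⟨?_, h2⟩
        rintro rfl
        omega
      · rintro ⟨h1, h2⟩
        refine ⟨?_, h2⟩
        rcases tr_step hG u h2 with h | h
        · exact absurd (tr_parent_unique hG h2 hxp h hp) h1
        · omega
    rw [this, card_erase_of_mem (by simpa using hxp), card_neighborFinset_eq_degree]
    rcases hdeg hD x with h | h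
    · exact absurd h hx.2
    · omega
  · intro y hy
    simp only [mem_filter, mem_univ, true_and] at hy
    have hne : u ≠ y := by
      rintro rfl
      simp at hy
    obtain ⟨p, hyp, hp⟩ := tr_parent hG hne
    have hne : u ≠ p := by
      rintro rfl
      rw [SimpleGraph.dist_self] at hp
      omega
    obtain ⟨q, hpq, hq⟩ := tr_parent hG hne
    rw [card_eq_one]
    refine ⟨p, ?_⟩
    ext x
    simp only [mem_filter, mem_univ, true_and, mem_singleton]
    constructor
    · rintro ⟨⟨h1, h2⟩, h3⟩
      exact tr_parent_unique hG h3.symm hyp (by omega) hp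
    · rintro rfl
      refine ⟨⟨by omega, deg_ne_one hyp.symm hpq ?_⟩, hyp.symm⟩
      rintro rfl
      omega

lemma leaf_iff {m D : ℕ} (hP : IsPerfectUnrootedMary m D G) (hD : 0 < D) {u v : W}
    (huv : G.dist v u = D) (x : W) : G.degree x = 1 ↔ G.dist v x = D ∨ G.dist u x = D := by
  obtain ⟨hG, hdeg, hmax, -, hleaf⟩ := hP
  constructor
  · intro hx
    obtain ⟨y, hy⟩ := hleaf x hx
    rw [SimpleGraph.dist_comm] at hy
    have h1 := hmax u x
    have h2 := hmax v x
    have h3 := hmax u y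
    have h4 := hmax v y
    rcases tr_fourpoint hG v u x y with h | h <;> omega
  · rintro (h | h)
    · exact deg_max hG hD (hmax v) h
    · exact deg_max hG hD (hmax u) h

lemma geo_card (hG : G.IsTree) {D : ℕ} {u v : W} (huv : G.dist v u = D) :
    ∀ j b : ℕ, j + b = D → #{x | G.dist v x = j ∧ G.dist u x = b} = 1 := by
  intro j
  induction j with
  | zero =>
    intro b hb
    rw [card_eq_one]
    refine ⟨v, ?_⟩
    ext x
    simp only [mem_filter, mem_univ, true_and, mem_singleton]
    constructor
    · rintro ⟨h, -⟩
      exact ((hG.connected.dist_eq_zero_iff).1 h).symm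
    · rintro rfl
      rw [SimpleGraph.dist_comm (u := u)]
      simp
      omega
  | succ j ih =>
    intro b hb
    have h0 := ih (b + 1) (by omega)
    have hkey : ∀ y, G.dist v u ≤ G.dist v y + G.dist u y := by
      intro y
      rw [SimpleGraph.dist_comm (u := u) (v := y)]
      exact hG.connected.dist_triangle
    rw [cnt_mul (G := G) {x | G.dist v x = j ∧ G.dist u x = b + 1} _ 1 ?_ ?_, h0]
    · intro x hx
      simp only [mem_filter, mem_univ, true_and] at hx
      have hne : u ≠ x := by
        rintro rfl
        simp at hx
      obtain ⟨p, hxp, hp⟩ := tr_parent hG hne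
      rw [card_eq_one]
      refine ⟨p, ?_⟩
      ext y
      simp only [mem_filter, mem_univ, true_and, mem_singleton]
      constructor
      · rintro ⟨⟨h1, h2⟩, h3⟩
        exact tr_parent_unique hG h3 hxp (by omega) hp
      · rintro rfl
        refine ⟨⟨?_, by omega⟩, hxp⟩
        have := hkey y
        rcases tr_step hG v hxp with h | h <;> omega
    · intro y hy
      simp only [mem_filter, mem_univ, true_and] at hy
      have hne : v ≠ y := by
        rintro rfl
        simp at hy
      obtain ⟨p, hyp, hp⟩ := tr_parent hG hne
      rw [card_eq_one]
      refine ⟨p, ?_⟩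
      ext x
      simp only [mem_filter, mem_univ, true_and, mem_singleton]
      constructor
      · rintro ⟨⟨h1, h2⟩, h3⟩
        exact tr_parent_unique hG h3.symm hyp (by omega) hp
      · rintro rfl
        refine ⟨⟨by omega, ?_⟩, hyp.symm⟩
        have := hkey x
        rcases tr_step hG u hyp with h | h <;> omega

/-- A vertex off the geodesic has the same neighbour towards both ends. -/
lemma common_parent (hG : G.IsTree) {u v y : W} (hy : G.dist v u < G.dist v y + G.dist u y) 
    (hv : v ≠ y) :
    ∃ p, G.Adj y p ∧ G.dist v y = G.dist v p + 1 ∧ G.dist u y = G.dist u p + 1 := by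
  obtain ⟨p, hyp, hp⟩ := tr_parent hG hv
  refine ⟨p, hyp, hp, ?_⟩
  rcases tr_step hG u hyp with h | h
  · exact h
  · have := tr_concat hG v u _ p y rfl hyp.symm hp h
    omega

lemma below_one (hG : G.IsTree) {u v y : W} {a b : ℕ} (hD : G.dist v u ≤ a + b)
    (h1 : G.dist v y = a + 1) (h2 : G.dist u y = b + 1) :
    #{x ∈ ({x | G.dist v x = a ∧ G.dist u x = b} : Finset W) | G.Adj x y} = 1 := by
  have hne : v ≠ y := by
    rintro rfl
    simp at h1
  obtain ⟨p, hyp, hp, hp'⟩ := common_parent (u := u) (v := v) hG (by omega) hne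
  rw [card_eq_one]
  refine ⟨p, ?_⟩
  ext x
  simp only [mem_filter, mem_univ, true_and, mem_singleton]
  constructor
  · rintro ⟨⟨h3, h4⟩, h5⟩
    exact tr_parent_unique hG h5.symm hyp (by omega) hp
  · rintro rfl
    exact ⟨⟨by omega, by omega⟩, hyp.symm⟩

lemma off_first {m D : ℕ} (hP : IsPerfectUnrootedMary m D G) (hD : 0 < D) {u v : W}
    (huv : G.dist v u = D) {j b : ℕ} (hj : 1 ≤ j) (hb : 1 ≤ b) (hjb : j + b = D) :
    #{x | G.dist v x = j + 1 ∧ G.dist u x = b + 1} = m - 1 := by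
  have hl := leaf_iff hP hD huv
  obtain ⟨hG, hdeg, hmax, -, hleaf⟩ := hP
  rw [cnt_mul (G := G) {x | G.dist v x = j ∧ G.dist u x = b} _ (m - 1) ?_ ?_,
    geo_card hG huv j b hjb, mul_one]
  · intro x hx
    simp only [mem_filter, mem_univ, true_and] at hx
    have hdx : G.degree x = m + 1 := by
      rcases hdeg hD x with h | h
      · rw [hl] at h
        omega
      · exact h
    have hne : u ≠ x := by
      rintro rfl
      simp at hx
      omega
    have hne' : v ≠ x := by
      rintro rfl
      simp at hx
      omega
    obtain ⟨p, hxp, hp⟩ := tr_parent hG hne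
    obtain ⟨q, hxq, hq⟩ := tr_parent hG hne'
    have hpq : p ≠ q := by
      rintro rfl
      have : G.dist v u ≤ G.dist v p + G.dist p u := hG.connected.dist_triangle
      rw [SimpleGraph.dist_comm (u := p)] at this
      omega
    have : ({y ∈ ({x | G.dist v x = j + 1 ∧ G.dist u x = b + 1} : Finset W) | G.Adj x y} : Finset W)
        = ((G.neighborFinset x).erase p).erase q := by
      ext y
      simp only [mem_filter, mem_univ, true_and, mem_erase, mem_neighborFinset]
      constructor
      · rintro ⟨h1, h2⟩
        refine ⟨?_, ?_, h2⟩
        · rintro rfl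
          omega
        · rintro rfl
          omega
      · rintro ⟨h1, h3, h2⟩
        refine ⟨⟨?_, ?_⟩, h2⟩
        · rcases tr_step hG v h2 with h | h
          · exact absurd (tr_parent_unique hG h2 hxq h hq) h1
          · omega
        · rcases tr_step hG u h2 with h | h
          · exact absurd (tr_parent_unique hG h2 hxp h hp) h3
          · omega
    rw [this, card_erase_of_mem (by simpa [hpq.symm] using hxq),
      card_erase_of_mem (by simpa using hxp), card_neighborFinset_eq_degree]
    omega
  · intro y hy
    simp only [mem_filter, mem_univ, true_and] at hy
    exact below_one hG (by omega) hy.1 hy.2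

lemma off_step {m D : ℕ} (hP : IsPerfectUnrootedMary m D G) (hD : 0 < D) {u v : W}
    (huv : G.dist v u = D) {a b : ℕ} (ha : a < D) (hb : b < D) (hab : D < a + b) :
    #{x | G.dist v x = a + 1 ∧ G.dist u x = b + 1} =
      m * #{x | G.dist v x = a ∧ G.dist u x = b} := by
  have hl := leaf_iff hP hD huv
  obtain ⟨hG, hdeg, hmax, -, hleaf⟩ := hP
  refine cnt_mul (G := G) _ _ m ?_ ?_
  · intro x hx
    simp only [mem_filter, mem_univ, true_and] at hx
    have hdx : G.degree x = m + 1 := by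
      rcases hdeg hD x with h | h
      · rw [hl] at h
        omega
      · exact h
    have hne' : v ≠ x := by
      rintro rfl
      simp at hx
      omega
    obtain ⟨p, hxp, hp, hq⟩ := common_parent (u := u) (v := v) hG (by omega) hne'
    have : ({y ∈ ({x | G.dist v x = a + 1 ∧ G.dist u x = b + 1} : Finset W) | G.Adj x y} : Finset W)
        = (G.neighborFinset x).erase p := by
      ext y
      simp only [mem_filter, mem_univ, true_and, mem_erase, mem_neighborFinset]
      constructor
      · rintro ⟨h1, h2⟩
        refine ⟨?_, h2⟩
        rintro rfl
        omega
      · rintro ⟨h1, h2⟩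
        refine ⟨⟨?_, ?_⟩, h2⟩
        · rcases tr_step hG v h2 with h | h
          · exact absurd (tr_parent_unique hG h2 hxp h hp) h1
          · omega
        · rcases tr_step hG u h2 with h | h
          · exact absurd (tr_parent_unique hG h2 hxp h hq) h1
          · omega
    rw [this, card_erase_of_mem (by simpa using hxp), card_neighborFinset_eq_degree]
    omega
  · intro y hy
    simp only [mem_filter, mem_univ, true_and] at hy
    exact below_one hG (by omega) hy.1 hy.2

lemma off_card {m D : ℕ} (hP : IsPerfectUnrootedMary m D G) (hD : 0 < D) {u v : W}
    (huv : G.dist v u = D) {j b : ℕ} (hj : 1 ≤ j) (hb : 1 ≤ b) (hjb : j + b = D) (e : ℕ) :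
    j + e < D → b + e < D →
    #{x | G.dist v x = j + e + 1 ∧ G.dist u x = b + e + 1} = (m - 1) * m ^ e := by
  induction e with
  | zero =>
    intro _ _
    simpa using off_first hP hD huv hj hb hjb
  | succ e ih =>
    intro h1 h2
    have := off_step hP hD huv (a := j + e + 1) (b := b + e + 1) (by omega) (by omega) (by omega)
    rw [ih (by omega) (by omega)] at this
    rw [pow_succ, ← mul_assoc, mul_comm, ← this]
    rfl

lemma leaf_sphere {m D : ℕ} (hm : 2 ≤ m) (hP : IsPerfectUnrootedMary m D G) (hD : 0 < D) {v : W}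
    (hv : G.degree v = 1) (t : ℕ) (ht : t ≤ D) : #{x | G.dist v x = t} = m ^ (t / 2) := by
  obtain ⟨u, huv⟩ := hP.2.2.2.2 v hv
  rw [SimpleGraph.dist_comm] at huv
  have hG := hP.1
  induction t with
  | zero =>
    rw [Nat.zero_div, pow_zero, card_eq_one]
    refine ⟨v, ?_⟩
    ext x
    simp only [mem_filter, mem_univ, true_and, mem_singleton]
    rw [hG.connected.dist_eq_zero_iff]
    exact eq_comm
  | succ t ih =>
    have ih := ih (by omega)
    rcases Nat.eq_zero_or_pos t with rfl | htp
    · have : ({x | G.dist v x = 0 + 1} : Finset W) = G.neighborFinset v := by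
        ext x
        simp [SimpleGraph.dist_eq_one_iff_adj]
      rw [this, card_neighborFinset_eq_degree, hv]
      simp
    · rw [sphere_step hP hD v htp]
      have hsplit : #{x | G.dist v x = t ∧ G.degree x ≠ 1} + #{x | G.dist v x = t ∧ G.dist u x = D}
          = #{x | G.dist v x = t} := by
        rw [← card_filter_add_card_filter_not (s := ({x | G.dist v x = t} : Finset W))
          (p := fun x => G.dist u x = D), filter_filter, filter_filter, add_comm]
        congr 2
        ext x
        simp only [mem_filter, mem_univ, true_and]
        rw [ne_eq, leaf_iff hP hD huv]
        constructor
        · rintro ⟨h1, h2⟩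
          exact ⟨h1, fun h => h2 (Or.inr h)⟩
        · rintro ⟨h1, h2⟩
          refine ⟨h1, ?_⟩
          rintro (h | h)
          · omega
          · exact h2 h
      rw [ih] at hsplit
      rcases Nat.even_or_odd' t with ⟨j, rfl | rfl⟩
      · have h1 := off_card hP hD huv (j := j) (b := D - j) (by omega) (by omega) (by omega) (j - 1)
          (by omega) (by omega)
        have e1 : j + (j - 1) + 1 = 2 * j := by omega
        have e2 : D - j + (j - 1) + 1 = D := by omega
        rw [e1, e2] at h1
        rw [h1] at hsplit
        have e3 : 2 * j / 2 = j := by omega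
        have e4 : (2 * j + 1) / 2 = j := by omega
        rw [e3] at hsplit
        rw [e4]
        obtain ⟨k, rfl⟩ : ∃ k, j = k + 1 := ⟨j - 1, by omega⟩
        obtain ⟨n, rfl⟩ : ∃ n, m = n + 1 := ⟨m - 1, by omega⟩
        simp only [Nat.add_sub_cancel] at hsplit
        have h5 : #{x | G.dist v x = 2 * (k + 1) ∧ G.degree x ≠ 1} = (n + 1) ^ k := by
          have e5 : (n + 1) ^ (k + 1) = n * (n + 1) ^ k + (n + 1) ^ k := by ring
          rw [e5] at hsplit
          omega
        rw [h5, pow_succ, mul_comm]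
      · have h1 : #{x | G.dist v x = 2 * j + 1 ∧ G.dist u x = D} = 0 := by
          rw [card_eq_zero, filter_eq_empty_iff]
          rintro x - ⟨h1, h2⟩
          obtain ⟨w, h3, h4, h5⟩ := tr_median hG v u _ x rfl
          omega
        rw [h1, add_zero] at hsplit
        rw [hsplit]
        have e3 : (2 * j + 1) / 2 = j := by omega
        have e4 : (2 * j + 1 + 1) / 2 = j + 1 := by omega
        rw [e3, e4, pow_succ, mul_comm]

lemma leaf_count {m D : ℕ} (hP : IsPerfectUnrootedMary m D G) (hD : 0 < D) :
    m * #{x | G.degree x = 1} + Fintype.card W = m * Fintype.card W + 2 := by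
  have h1 := hP.1.card_edgeFinset
  have h2 := G.sum_degrees_eq_twice_card_edges
  have h3 : ∑ x, G.degree x + m * #{x | G.degree x = 1} = (m + 1) * Fintype.card W := by
    have : ∀ x, G.degree x + (if G.degree x = 1 then m else 0) = m + 1 := by
      intro x
      rcases hP.2.1 hD x with h | h
      · rw [h]
        simp [add_comm]
      · rw [h]
        split_ifs <;> omega
    have h4 : ∑ x, (G.degree x + (if G.degree x = 1 then m else 0)) = (m + 1) * Fintype.card W := by
      rw [sum_congr rfl (fun x _ => this x)]
      simp [mul_comm]
    rw [sum_add_distrib, ← sum_filter, sum_const, smul_eq_mul, mul_comm _ m] at h4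
    exact h4
  rw [Nat.add_mul] at h3
  omega

/-- Ordered pairs at distance `t`. -/
lemma pair_step {m D : ℕ} (hm : 2 ≤ m) (hP : IsPerfectUnrootedMary m D G) (hD : 0 < D) {t : ℕ}
    (ht : 1 ≤ t) (htD : t ≤ D) :
    ∑ u, #{x | G.dist u x = t + 1} + m * (#{x | G.degree x = 1} * m ^ (t / 2)) =
      m * ∑ u, #{x | G.dist u x = t} := by
  have h1 : ∑ u, #{x | G.dist u x = t ∧ G.degree x = 1} = #{x | G.degree x = 1} * m ^ (t / 2) := by
    have : ∀ u, #{x | G.dist u x = t ∧ G.degree x = 1} =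
        ∑ x ∈ {x | G.degree x = 1}, if G.dist u x = t then 1 else 0 := by
      intro u
      rw [← card_filter, filter_filter]
      congr 1
      ext x
      simp [and_comm]
    rw [sum_congr rfl (fun u _ => this u), sum_comm]
    rw [← smul_eq_mul, ← sum_const]
    refine sum_congr rfl ?_
    intro x hx
    rw [← leaf_sphere hm hP hD (v := x) (by simpa using hx) t htD, card_filter]
    refine sum_congr rfl ?_
    intro u _
    rw [SimpleGraph.dist_comm]
  rw [← h1, ← Nat.mul_comm, sum_mul, ← sum_add_distrib, mul_sum]
  refine sum_congr rfl ?_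
  intro u _
  rw [sphere_step hP hD u ht, mul_comm _ m, ← Nat.mul_add]
  congr 1
  rw [← card_filter_add_card_filter_not (s := ({x | G.dist u x = t} : Finset W))
          (p := fun x => G.degree x = 1), filter_filter, filter_filter, add_comm]

lemma pair_count {m D : ℕ} (hm : 2 ≤ m) (hP : IsPerfectUnrootedMary m D G) (hD : 0 < D)
    (X : ℕ → ℚ) (hX0 : X 0 = 2) (hX : ∀ k, X (k + 1) = m * X k + 2) (k : ℕ)
    (hk : 2 * (k + 1) ≤ D) :
    ((∑ u, #{x | G.dist u x = 2 * (k + 1)} : ℕ) : ℚ) =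
      ((m : ℚ) + 1) * m ^ k * (Fintype.card W - X k) := by
  have hl : (m : ℚ) * (#{x | G.degree x = 1} : ℕ) + Fintype.card W = m * Fintype.card W + 2 := by
    exact_mod_cast leaf_count hP hD
  induction k with
  | zero =>
    have h1 : ∑ u, #{x | G.dist u x = 1} + 2 = 2 * Fintype.card W := by
      have h1 := hP.1.card_edgeFinset
      have h2 := G.sum_degrees_eq_twice_card_edges
      have : ∀ u, #{x | G.dist u x = 1} = G.degree u := by
        intro u
        rw [← card_neighborFinset_eq_degree]
        congr 1
        ext x
        simp [SimpleGraph.dist_eq_one_iff_adj]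
      rw [sum_congr rfl (fun u _ => this u)]
      omega
    have h2 := pair_step hm hP hD (t := 1) le_rfl (by omega)
    have h1' : ((∑ u, #{x | G.dist u x = 1} : ℕ) : ℚ) + 2 = 2 * Fintype.card W := by
      exact_mod_cast h1
    have h2' : ((∑ u, #{x | G.dist u x = 2} : ℕ) : ℚ) + m * ((#{x | G.degree x = 1} : ℕ) * 1) =
        m * (∑ u, #{x | G.dist u x = 1} : ℕ) := by
      exact_mod_cast h2
    have e : (∑ u, #{x | G.dist u x = 2 * (0 + 1)} : ℕ) = ∑ u, #{x | G.dist u x = 2} := rfl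
    rw [e, hX0]
    linear_combination h2' - hl + (m : ℚ) * h1'
  | succ k ih =>
    have h0 := ih (by omega)
    have h1 := pair_step hm hP hD (t := 2 * (k + 1)) (by omega) (by omega)
    have h2 := pair_step hm hP hD (t := 2 * (k + 1) + 1) (by omega) (by omega)
    have e1 : (2 * (k + 1)) / 2 = k + 1 := by omega
    have e2 : (2 * (k + 1) + 1) / 2 = k + 1 := by omega
    rw [e1] at h1
    rw [e2] at h2
    have h1' := congrArg (Nat.cast (R := ℚ)) h1
    have h2' := congrArg (Nat.cast (R := ℚ)) h2
    rw [Nat.cast_add, Nat.cast_mul, Nat.cast_mul, Nat.cast_mul, Nat.cast_pow] at h1' h2'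
    have e : (∑ u, #{x | G.dist u x = 2 * (k + 1 + 1)} : ℕ) =
      ∑ u, #{x | G.dist u x = 2 * (k + 1) + 1 + 1} := rfl
    rw [h0] at h1'
    rw [e, hX]
    rw [pow_succ] at *
    linear_combination h2' + (m : ℚ) * h1' - ((m : ℚ) + 1) * m ^ k * m * hl

lemma pathCount_eq (t : ℕ) (ht : 1 ≤ t) :
    2 * pathCount G t = ∑ u, #{x | G.dist u x = t} := by
  classical
  let K : SimpleGraph W :=
    { Adj := fun x y => G.dist x y = t
      symm := ⟨fun x y h => by rw [SimpleGraph.dist_comm]; exact h⟩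
      loopless := ⟨fun x h => by simp at h; omega⟩ }
  have h := K.sum_degrees_eq_twice_card_edges
  have h1 : ∀ u, K.degree u = #{x | G.dist u x = t} := by
    intro u
    rw [← card_neighborFinset_eq_degree]
    congr 1
    ext x
    simp [K]
  rw [← sum_congr rfl (fun u _ => h1 u), h]
  congr 1
  unfold pathCount
  congr 1
  ext p
  induction p with
  | _ x y =>
    simp only [mem_filter, mem_univ, true_and, mem_edgeFinset, mem_edgeSet]
    constructor
    · rintro ⟨a, b, h1, h2⟩
      rw [Sym2.eq_iff] at h1
      rcases h1 with ⟨rfl, rfl⟩ | ⟨rfl, rfl⟩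
      · exact h2
      · exact SimpleGraph.dist_comm.trans h2
    · intro h
      exact ⟨x, y, rfl, h⟩

end Counting

section Graft

variable {X : Type} [Fintype X] [DecidableEq X] (H : SimpleGraph X) [DecidableRel H.Adj]

/-- Attach `m` new leaves to every leaf of `H`. -/
def graft (m : ℕ) : SimpleGraph (X ⊕ ({x : X // H.degree x = 1} × Fin m)) where
  Adj a b := match a, b with
    | Sum.inl a, Sum.inl b => H.Adj a b
    | Sum.inl a, Sum.inr p => p.1.1 = a
    | Sum.inr p, Sum.inl a => p.1.1 = a
    | Sum.inr _, Sum.inr _ => False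
  symm := ⟨by
    rintro (a | p) (b | q) h
    · exact SimpleGraph.Adj.symm (G := H) h
    · exact h
    · exact h
    · exact h⟩
  loopless := ⟨by
    rintro (a | p) h
    · exact H.loopless.irrefl a h
    · exact h⟩

variable {H}

lemma graft_connected (m : ℕ) (hc : H.Connected) : (graft H m).Connected := by
  let f : H →g graft H m := ⟨Sum.inl, fun {a b} h => h⟩
  obtain ⟨x0⟩ := hc.nonempty
  have h1 : ∀ y, (graft H m).Reachable y (Sum.inl x0) := by
    have h0 : ∀ a : X, (graft H m).Reachable (Sum.inl a) (Sum.inl x0) := fun a =>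
      (hc.preconnected a x0).map f
    rintro (a | p)
    · exact h0 a
    · have : (graft H m).Adj (Sum.inr p) (Sum.inl p.1.1) := rfl
      exact this.reachable.trans (h0 _)
  have : Nonempty (X ⊕ ({x : X // H.degree x = 1} × Fin m)) := ⟨Sum.inl x0⟩
  exact ⟨fun a b => (h1 a).trans (h1 b).symm⟩

lemma graft_proj (m : ℕ) (hc : H.Connected) {a b : X ⊕ ({x : X // H.degree x = 1} × Fin m)}
    (w : (graft H m).Walk a b) :
    H.dist (Sum.elim id (fun p => p.1.1) a) (Sum.elim id (fun p => p.1.1) b) ≤ w.length := by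
  induction w with
  | nil => simp
  | @cons a c b h q ih =>
    rw [SimpleGraph.Walk.length_cons]
    have h1 : H.dist (Sum.elim id (fun p => p.1.1) a) (Sum.elim id (fun p => p.1.1) c) ≤ 1 := by
      rcases a with a | a <;> rcases c with c | c
      · have h' : H.Adj a c := h
        exact (SimpleGraph.dist_eq_one_iff_adj.2 h').le
      · have h' : c.1.1 = a := h
        simp [h']
      · have h' : a.1.1 = c := h
        simp [h']
      · exact absurd h id
    have h2 : H.dist (Sum.elim id (fun p => p.1.1) a) (Sum.elim id (fun p => p.1.1) b) ≤
        H.dist (Sum.elim id (fun p => p.1.1) a) (Sum.elim id (fun p => p.1.1) c) +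
        H.dist (Sum.elim id (fun p => p.1.1) c) (Sum.elim id (fun p => p.1.1) b) :=
      hc.dist_triangle
    omega

lemma graft_dist (m : ℕ) (hc : H.Connected) (a b : X) :
    (graft H m).dist (Sum.inl a) (Sum.inl b) = H.dist a b := by
  apply le_antisymm
  · let f : H →g graft H m := ⟨Sum.inl, fun {a b} h => h⟩
    obtain ⟨w, hw⟩ := hc.exists_walk_length_eq_dist a b
    rw [← hw, ← SimpleGraph.Walk.length_map f w]
    exact SimpleGraph.dist_le _
  · obtain ⟨w, hw⟩ := (graft_connected m hc).exists_walk_length_eq_dist (Sum.inl a) (Sum.inl b)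
    rw [← hw]
    exact graft_proj m hc w

lemma graft_deg_inr (m : ℕ) [DecidableRel (graft H m).Adj]
    (p : {x : X // H.degree x = 1} × Fin m) : (graft H m).degree (Sum.inr p) = 1 := by
  rw [SimpleGraph.degree_eq_one_iff_existsUnique_adj]
  refine ⟨Sum.inl p.1.1, rfl, ?_⟩
  rintro (a | q) h
  · have h' : p.1.1 = a := h
    rw [h']
  · exact absurd h id

lemma graft_deg_inl (m : ℕ) [DecidableRel (graft H m).Adj] (a : X) :
    (graft H m).degree (Sum.inl a) = H.degree a + if H.degree a = 1 then m else 0 := by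
  have h1 : (graft H m).neighborFinset (Sum.inl a) =
      (H.neighborFinset a).disjSum {p | p.1.1 = a} := by
    ext (b | q)
    · simp only [mem_neighborFinset, inl_mem_disjSum]
      exact Iff.rfl
    · simp only [mem_neighborFinset, inr_mem_disjSum, mem_filter, mem_univ, true_and]
      exact Iff.rfl
  rw [← card_neighborFinset_eq_degree, h1, card_disjSum, card_neighborFinset_eq_degree]
  congr 1
  split_ifs with h
  · have : ({p | p.1.1 = a} : Finset ({x : X // H.degree x = 1} × Fin m)) =
        {⟨a, h⟩} ×ˢ univ := by
      ext ⟨⟨x, hx⟩, i⟩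
      simp [eq_comm]
    rw [this, card_product]
    simp
  · rw [card_eq_zero, filter_eq_empty_iff]
    rintro ⟨⟨x, hx⟩, i⟩ - h'
    simp at h'
    subst h'
    exact h hx

lemma graft_tree (m : ℕ) (hT : H.IsTree) : (graft H m).IsTree := by
  classical
  rw [isTree_iff_connected_and_card]
  refine ⟨graft_connected m hT.connected, ?_⟩
  have h1 := hT.card_edgeFinset
  have h2 := H.sum_degrees_eq_twice_card_edges
  have h3 := (graft H m).sum_degrees_eq_twice_card_edges
  rw [Fintype.sum_sum_type, sum_congr rfl (fun a _ => graft_deg_inl m a),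
    sum_congr rfl (fun a _ => graft_deg_inr m a), sum_add_distrib, ← sum_filter, sum_const,
    sum_const, card_univ, Fintype.card_prod, Fintype.card_fin, Fintype.card_subtype] at h3
  rw [Nat.card_eq_fintype_card, Nat.card_eq_fintype_card, Fintype.card_sum, Fintype.card_prod,
    Fintype.card_fin, ← edgeFinset_card, Fintype.card_subtype (fun x : X => H.degree x = 1)]
  simp only [smul_eq_mul, mul_one] at h3
  omega

lemma graft_dist_inr (m : ℕ) (hT : H.IsTree) (p : {x : X // H.degree x = 1} × Fin m)
    (y : X ⊕ ({x : X // H.degree x = 1} × Fin m)) (hy : y ≠ Sum.inr p) :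
    (graft H m).dist y (Sum.inr p) = (graft H m).dist y (Sum.inl p.1.1) + 1 := by
  obtain ⟨q, hq, hd⟩ := tr_parent (graft_tree m hT) hy
  rcases q with b | q
  · have h' : p.1.1 = b := hq
    rw [h', hd]
  · exact absurd hq id

lemma graft_perfect {m d : ℕ} (hm : 2 ≤ m) (hd : 0 < d) (hP : IsPerfectUnrootedMary m d H)
    [DecidableRel (graft H m).Adj] : IsPerfectUnrootedMary m (d + 2) (graft H m) := by
  obtain ⟨hT, hdeg, hmax, ⟨u, v, huv⟩, hleaf⟩ := hP
  have hT' := graft_tree m hT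
  have hc := hT.connected
  have hi : ∀ (p : {x : X // H.degree x = 1} × Fin m) (a : X),
      (graft H m).dist (Sum.inl a) (Sum.inr p) = H.dist a p.1.1 + 1 := by
    intro p a
    rw [graft_dist_inr m hT p _ (by simp), graft_dist m hc]
  have hr : ∀ (p q : {x : X // H.degree x = 1} × Fin m), p ≠ q →
      (graft H m).dist (Sum.inr p) (Sum.inr q) = H.dist q.1.1 p.1.1 + 2 := by
    intro p q hpq
    rw [graft_dist_inr m hT q _ (by simpa using hpq), SimpleGraph.dist_comm, hi]
  have hl : ∀ p : {x : X // H.degree x = 1} × Fin m, ∃ q,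
      (graft H m).dist q (Sum.inr p) = d + 2 := by
    intro p
    obtain ⟨z, hz⟩ := hleaf p.1.1 p.1.2
    have hz1 : H.degree z = 1 := by
      rw [SimpleGraph.dist_comm] at hz
      exact deg_max hT hd (hmax _) hz
    refine ⟨Sum.inr (⟨z, hz1⟩, ⟨0, by omega⟩), ?_⟩
    rw [hr, SimpleGraph.dist_comm, hz]
    intro hp
    have hzp : z = p.1.1 := congrArg (fun q => q.1.1) hp
    rw [hzp, SimpleGraph.dist_self] at hz
    omega
  refine ⟨hT', ?_, ?_, ?_, ?_⟩
  · rintro - (a | p)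
    · right
      rw [graft_deg_inl]
      rcases hdeg hd a with h | h
      · rw [if_pos h]
        omega
      · rw [if_neg (by omega)]
        omega
    · left
      exact graft_deg_inr m p
  · rintro (a | p) (b | q)
    · rw [graft_dist m hc]
      have := hmax a b
      omega
    · rw [hi]
      have := hmax a q.1.1
      omega
    · rw [SimpleGraph.dist_comm, hi]
      have := hmax b p.1.1
      omega
    · by_cases h : p = q
      · subst h
        simp
      · rw [hr p q h]
        have := hmax q.1.1 p.1.1
        omega
  · have hv1 : H.degree v = 1 := deg_max hT hd (hmax _) huv
    obtain ⟨q, hq⟩ := hl (⟨v, hv1⟩, ⟨0, by omega⟩)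
    exact ⟨_, _, hq⟩
  · rintro (a | p) h
    · exfalso
      rw [graft_deg_inl] at h
      rcases hdeg hd a with h' | h'
      · rw [if_pos h'] at h
        omega
      · rw [if_neg (by omega)] at h
        omega
    · exact hl p

end Graft

/-- Vertex numbers of perfect trees of odd diameter `2 k + 1`. -/
def oddV (m : ℕ) : ℕ → ℕ
  | 0 => 2
  | k + 1 => m * oddV m k + 2

lemma exists_perfect (m : ℕ) (hm : 2 ≤ m) (k : ℕ) :
    ∃ (X : Type) (_ : Fintype X) (H : SimpleGraph X) (_ : DecidableRel H.Adj),
      IsPerfectUnrootedMary m (2 * k + 1) H ∧ Fintype.card X = oddV m k := by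
  classical
  induction k with
  | zero =>
    have hdeg : ∀ v : Fin 2, (⊤ : SimpleGraph (Fin 2)).degree v = 1 := by
      intro v
      rw [SimpleGraph.complete_graph_degree]
      simp
    refine ⟨Fin 2, inferInstance, ⊤, inferInstance, ⟨⟨connected_top, ?_⟩, ?_, ?_, ?_, ?_⟩, rfl⟩
    · exact IsAcyclic.of_card_le_two (by simp)
    · intro _ v
      left
      exact hdeg v
    · intro u v
      rw [SimpleGraph.dist_top]
      split_ifs <;> omega
    · exact ⟨0, 1, by simp [SimpleGraph.dist_top]⟩
    · intro v _
      refine ⟨v + 1, ?_⟩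
      rw [SimpleGraph.dist_top_of_ne]
      simp
  | succ k ih =>
    obtain ⟨X, _, H, _, hP, hX⟩ := ih
    refine ⟨_, inferInstance, graft H m, Classical.decRel _, ?_, ?_⟩
    · exact @graft_perfect X _ _ H _ m (2 * k + 1) hm (by omega) hP (Classical.decRel _)
    · have := leaf_count hP (by omega)
      rw [Fintype.card_sum, Fintype.card_prod, Fintype.card_fin, Fintype.card_subtype, oddV, ← hX]
      rw [mul_comm] at this
      omega

theorem unrooted_path_count_even (m D : ℕ) (hm : 2 ≤ m)
    {W : Type} [Fintype W] [DecidableEq W] (G : SimpleGraph W) [DecidableRel G.Adj]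
    (hG : IsPerfectUnrootedMary m D G)
    (Vf : ℕ → ℚ)
    (hVf : ∀ (d : ℕ) (X : Type) [Fintype X] (H : SimpleGraph X) [DecidableRel H.Adj],
      IsPerfectUnrootedMary m d H → (Fintype.card X : ℚ) = Vf d)
    (t : ℕ) (ht : Even t) (ht1 : 1 ≤ t) (htD : t ≤ D) :
    (pathCount G t : ℚ) =
      (1 / 2) * ((m : ℚ) + 1) * (m : ℚ) ^ (t / 2 - 1) * (Vf D - Vf (t - 1)) := by
  obtain ⟨k, rfl⟩ : ∃ k, t = 2 * (k + 1) := by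
    obtain ⟨r, hr⟩ := ht
    exact ⟨r - 1, by omega⟩
  obtain ⟨X, iX, H, iH, hP, hX⟩ := exists_perfect m hm k
  have h1 := hVf _ X H hP
  have h2 := hVf _ W G hG
  have h3 := pair_count hm hG (by omega) (fun k => (oddV m k : ℚ)) (by simp [oddV])
    (by intro k; simp [oddV]) k htD
  rw [← pathCount_eq _ (by omega)] at h3
  have e1 : 2 * (k + 1) - 1 = 2 * k + 1 := by omega
  have e2 : 2 * (k + 1) / 2 - 1 = k := by omega
  rw [e1, e2, ← h1, ← h2, hX]
  push_cast at h3
  linarith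
end

section
/- Let m ≥ 2 and let T be the perfect rooted m-ary tree of depth r. If t is odd and r < t ≤ 2r, then the number of paths of length t in T equals m^((t−1)/2) · (V_R(r) − V_R((t−1)/2)) − (r − (t−1)/2) · m^(t−1), where V_R(d) is the number of vertices in the perfect rooted m-ary tree of depth d. -/
open SimpleGraph Finset

/-- `IsPerfectRootedMary m r H ρ` says that `H` is the perfect rooted `m`-ary tree of
depth `r` with root `ρ`: a tree whose root `ρ` has degree `m`, in which every other
vertex has degree `1` or `m + 1`, whose maximum distance from `ρ` to a vertex is `r`,
and in which every degree-`1` vertex is at distance exactly `r` from `ρ`.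
(For `r = 0` the root-degree condition is dropped, so that the one-vertex tree is the
perfect rooted tree of depth `0`.) -/
def IsPerfectRootedMary (m r : ℕ) {W : Type} [Fintype W] (H : SimpleGraph W)
    [DecidableRel H.Adj] (ρ : W) : Prop :=
  H.IsTree ∧
    (0 < r → H.degree ρ = m) ∧
    (∀ v : W, v ≠ ρ → H.degree v = 1 ∨ H.degree v = m + 1) ∧
    (∀ v : W, H.dist ρ v ≤ r) ∧
    (∃ v : W, H.dist ρ v = r) ∧
    (∀ v : W, H.degree v = 1 → H.dist ρ v = r)

section Helpers

variable {W : Type} {G : SimpleGraph W}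

lemma hp_closer (hT : G.IsTree) {u v : W} (h : u ≠ v) :
    ∃ x, G.Adj v x ∧ G.dist u x + 1 = G.dist u v := by
  obtain ⟨p, hp⟩ := hT.connected.exists_walk_length_eq_dist v u
  cases p with
  | nil => exact absurd rfl h
  | cons hadj q =>
    rename_i x
    refine ⟨x, hadj, ?_⟩
    have h1 := SimpleGraph.dist_le q
    rw [SimpleGraph.Walk.length_cons, SimpleGraph.dist_comm] at hp
    rw [SimpleGraph.dist_comm] at h1
    have := hT.dist_eq_dist_add_one_of_adj u hadj
    omega

lemma hp_unique (hT : G.IsTree) {u v x y : W} (hx : G.Adj v x) (hy : G.Adj v y)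
    (dx : G.dist u x + 1 = G.dist u v) (dy : G.dist u y + 1 = G.dist u v) : x = y := by
  obtain ⟨p, hp⟩ := hT.connected.exists_walk_length_eq_dist u x
  obtain ⟨q, hq⟩ := hT.connected.exists_walk_length_eq_dist u y
  have h1 : (p.concat hx.symm).IsPath :=
    SimpleGraph.Walk.isPath_of_length_eq_dist _ (by rw [SimpleGraph.Walk.length_concat]; omega)
  have h2 : (q.concat hy.symm).IsPath :=
    SimpleGraph.Walk.isPath_of_length_eq_dist _ (by rw [SimpleGraph.Walk.length_concat]; omega)
  have h3 := (hT.existsUnique_path u v).unique h1 h2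
  have := congrArg SimpleGraph.Walk.penultimate h3
  simpa using this

lemma hp_parity (hT : G.IsTree) (ρ u v : W) :
    Even (G.dist u v + G.dist ρ u + G.dist ρ v) := by
  induction hn : G.dist u v generalizing v with
  | zero =>
    have : u = v := (hT.connected.dist_eq_zero_iff).1 hn
    subst this
    simp
  | succ n ih =>
    have huv : u ≠ v := by rintro rfl; simp at hn
    obtain ⟨x, hx, hd⟩ := hp_closer hT huv
    have h1 := ih x (by omega)
    have h2 := hT.dist_eq_dist_add_one_of_adj ρ hx
    rw [Nat.even_iff] at *
    omega

/-- the key monotonicity: if the last step of a geodesic from `u` goes towards the root, all do -/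
lemma hp_desc (hT : G.IsTree) (ρ u : W) (n : ℕ) : ∀ v x, G.Adj v x → G.dist u v = n + 1 →
    G.dist u x = n → G.dist ρ x = G.dist ρ v + 1 → G.dist ρ u = G.dist ρ v + n + 1 := by
  induction n with
  | zero =>
    intro v x hx hv h0 hd
    have : u = x := (hT.connected.dist_eq_zero_iff).1 h0
    subst this
    omega
  | succ n ih =>
    intro v x hx hv h0 hd
    have hux : u ≠ x := by rintro rfl; simp at h0
    obtain ⟨y, hy, hyd⟩ := hp_closer hT hux
    have hyv : y ≠ v := by rintro rfl; omega
    have h2 := hT.dist_eq_dist_add_one_of_adj ρ hy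
    have h3 : G.dist ρ y = G.dist ρ x + 1 := by
      rcases h2 with h2 | h2
      · exact absurd (hp_unique hT (u := ρ) hy hx.symm (by omega) (by omega)) hyv
      · exact h2
    have := ih x y hy (by omega) (by omega) h3
    omega

open Classical in
/-- the parent of a vertex -/
noncomputable def hpPar (G : SimpleGraph W) (ρ v : W) : W :=
  if h : ∃ x, G.Adj v x ∧ G.dist ρ x + 1 = G.dist ρ v then h.choose else v

lemma hp_par_spec (hT : G.IsTree) {ρ v : W} (h : 0 < G.dist ρ v) :
    G.Adj v (hpPar G ρ v) ∧ G.dist ρ (hpPar G ρ v) + 1 = G.dist ρ v := by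
  have hne : ρ ≠ v := by rintro rfl; simp at h
  have := hp_closer hT hne
  unfold hpPar
  rw [dif_pos this]
  exact this.choose_spec

lemma hp_par_eq (hT : G.IsTree) {ρ v x : W} (hx : G.Adj v x)
    (h : G.dist ρ x + 1 = G.dist ρ v) : hpPar G ρ v = x := by
  have := hp_par_spec hT (ρ := ρ) (v := v) (by omega)
  exact hp_unique hT this.1 hx this.2 h

lemma hp_dist_par (hT : G.IsTree) {ρ u v : W} (hne : u ≠ v) (h : G.dist ρ u ≤ G.dist ρ v) :
    0 < G.dist ρ v ∧ G.dist u v = G.dist u (hpPar G ρ v) + 1 := by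
  have h0 : 0 < G.dist ρ v := by
    rcases Nat.eq_zero_or_pos (G.dist ρ v) with h0 | h0
    · have h1 : ρ = v := (hT.connected.dist_eq_zero_iff).1 h0
      have h2 : ρ = u := (hT.connected.dist_eq_zero_iff).1 (by omega)
      exact absurd (h2.symm.trans h1) hne
    · exact h0
  refine ⟨h0, ?_⟩
  obtain ⟨x, hx, hd⟩ := hp_closer hT hne
  rcases hT.dist_eq_dist_add_one_of_adj ρ hx with h2 | h2
  · rw [hp_par_eq hT hx (by omega)]; omega
  · have := hp_desc hT ρ u _ v x hx hd.symm rfl h2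
    omega

lemma hp_dist_par2 (hT : G.IsTree) {ρ u v : W} (hne : u ≠ v) (h : G.dist ρ u = G.dist ρ v) :
    G.dist u v = G.dist (hpPar G ρ u) (hpPar G ρ v) + 2 := by
  obtain ⟨h0, h1⟩ := hp_dist_par hT hne h.le
  obtain ⟨h3, h4⟩ := hp_par_spec hT h0
  have hne2 : hpPar G ρ v ≠ u := by intro h5; rw [h5] at h4; omega
  obtain ⟨h6, h7⟩ := hp_dist_par (ρ := ρ) hT hne2 (by omega)
  rw [SimpleGraph.dist_comm] at h7
  rw [h1, h7, SimpleGraph.dist_comm]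

variable [Fintype W] [DecidableEq W] [DecidableRel G.Adj] {ρ : W} {m r : ℕ}

lemma hp_children (hG : IsPerfectRootedMary m r G ρ) (hr : 0 < r) {w : W} (hw : G.dist ρ w < r) :
    #{u | G.dist ρ u = G.dist ρ w + 1 ∧ hpPar G ρ u = w} = m := by
  obtain ⟨hT, hroot, hdeg, -, -, hleaf⟩ := hG
  have hset : ({u | G.dist ρ u = G.dist ρ w + 1 ∧ hpPar G ρ u = w} : Finset W)
      = (G.neighborFinset w).filter (fun u => G.dist ρ u = G.dist ρ w + 1) := by
    ext u
    simp only [Finset.mem_filter, Finset.mem_univ, true_and, SimpleGraph.mem_neighborFinset]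
    constructor
    · rintro ⟨h1, h2⟩
      refine ⟨?_, h1⟩
      have := (hp_par_spec hT (ρ := ρ) (v := u) (by omega)).1
      rw [h2] at this
      exact this.symm
    · rintro ⟨h1, h2⟩
      exact ⟨h2, hp_par_eq hT h1.symm h2.symm⟩
  rw [hset]
  by_cases hwr : w = ρ
  · rw [Finset.filter_true_of_mem, SimpleGraph.card_neighborFinset_eq_degree, hwr, hroot hr]
    intro u hu
    rw [SimpleGraph.mem_neighborFinset] at hu
    have := hT.dist_eq_dist_add_one_of_adj ρ hu
    subst hwr
    simp at this ⊢
    omega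
  · have hd : G.degree w = m + 1 := by
      rcases hdeg w hwr with h | h
      · have := hleaf w h; omega
      · exact h
    have h0 : 0 < G.dist ρ w := by
      rw [Nat.pos_iff_ne_zero]
      intro h
      exact hwr ((hT.connected.dist_eq_zero_iff).1 h).symm
    obtain ⟨ha, hb⟩ := hp_par_spec hT h0
    have : (G.neighborFinset w).filter (fun u => G.dist ρ u = G.dist ρ w + 1)
        = (G.neighborFinset w).erase (hpPar G ρ w) := by
      ext u
      simp only [Finset.mem_filter, Finset.mem_erase, SimpleGraph.mem_neighborFinset]
      constructor
      · rintro ⟨h1, h2⟩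
        refine ⟨?_, h1⟩
        rintro rfl
        omega
      · rintro ⟨h1, h2⟩
        refine ⟨h2, ?_⟩
        rcases hT.dist_eq_dist_add_one_of_adj ρ h2 with h3 | h3
        · exact absurd (hp_par_eq hT h2 h3.symm).symm h1
        · exact h3
    rw [this, Finset.card_erase_of_mem (by simpa using ha),
      SimpleGraph.card_neighborFinset_eq_degree, hd]
    rfl

lemma hp_fiber (hG : IsPerfectRootedMary m r G ρ) {h : ℕ} (hr : h < r) (S : Finset W)
    (hS : ∀ w ∈ S, G.dist ρ w = h) :
    #{u | G.dist ρ u = h + 1 ∧ hpPar G ρ u ∈ S} = m * #S := by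
  rw [Finset.card_eq_sum_card_fiberwise (f := hpPar G ρ) (t := S)]
  · rw [Finset.sum_const_nat (m := m), mul_comm]
    intro w hw
    rw [← hp_children hG (by omega) (w := w) (by rw [hS w hw]; exact hr), Finset.filter_filter]
    congr 1
    ext u
    simp only [Finset.mem_filter, Finset.mem_univ, true_and]
    rw [hS w hw]
    constructor
    · rintro ⟨⟨a, b⟩, c⟩; exact ⟨a, c⟩
    · rintro ⟨a, c⟩; exact ⟨⟨a, c ▸ hw⟩, c⟩
  · intro u hu
    simp at hu
    exact hu.2

lemma hp_level (hG : IsPerfectRootedMary m r G ρ) (h : ℕ) (hr : h ≤ r) :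
    #{u | G.dist ρ u = h} = m ^ h := by
  induction h with
  | zero =>
    rw [pow_zero, Finset.card_eq_one]
    refine ⟨ρ, ?_⟩
    ext u
    simp only [Finset.mem_filter, Finset.mem_univ, true_and, Finset.mem_singleton,
      hG.1.connected.dist_eq_zero_iff]
    exact eq_comm
  | succ h ih =>
    rw [pow_succ', ← ih (by omega), ← hp_fiber hG (h := h) (by omega) _ (by simp)]
    congr 1
    ext u
    simp only [Finset.mem_filter, Finset.mem_univ, true_and, iff_self_and]
    intro hu
    have := (hp_par_spec hG.1 (ρ := ρ) (v := u) (by omega)).2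
    omega

lemma hp_near (hG : IsPerfectRootedMary m r G ρ) (s : ℕ) : ∀ v, s ≤ G.dist ρ v →
    #{u | G.dist ρ u = G.dist ρ v ∧ G.dist u v ≤ 2 * s} = m ^ s := by
  have hT := hG.1
  induction s with
  | zero =>
    intro v _
    rw [pow_zero, Finset.card_eq_one]
    refine ⟨v, ?_⟩
    ext u
    simp only [Finset.mem_filter, Finset.mem_univ, true_and, Finset.mem_singleton,
      hT.connected.dist_eq_zero_iff, mul_zero, Nat.le_zero]
    constructor
    · exact fun h => h.2
    · rintro rfl; exact ⟨rfl, rfl⟩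
  | succ s ih =>
    intro v hv
    obtain ⟨ha, hb⟩ := hp_par_spec hT (ρ := ρ) (v := v) (by omega)
    have hvr := hG.2.2.2.1 v
    rw [pow_succ', ← ih (hpPar G ρ v) (by omega),
      ← hp_fiber hG (h := G.dist ρ (hpPar G ρ v)) (by omega) _ (by simp +contextual)]
    congr 1
    ext u
    simp only [Finset.mem_filter, Finset.mem_univ, true_and]
    rw [hb]
    refine and_congr_right fun hu => ?_
    have hc := (hp_par_spec hT (ρ := ρ) (v := u) (by omega)).2
    by_cases huv : u = v
    · subst huv; simp
    · have := hp_dist_par2 hT huv hu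
      omega

lemma hp_same (hG : IsPerfectRootedMary m r G ρ) (s : ℕ) (v : W) (hs : s + 1 ≤ G.dist ρ v) :
    #{u | G.dist ρ u = G.dist ρ v ∧ G.dist u v = 2 * (s + 1)} + m ^ s = m ^ (s + 1) := by
  rw [← hp_near hG s v (by omega), ← hp_near hG (s + 1) v hs, ← Finset.card_union_of_disjoint]
  · congr 1
    ext u
    simp only [Finset.mem_union, Finset.mem_filter, Finset.mem_univ, true_and]
    have := hp_parity hG.1 ρ u v
    rw [Nat.even_iff] at this
    omega
  · rw [Finset.disjoint_left]
    intro u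
    simp only [Finset.mem_filter, Finset.mem_univ, true_and]
    omega

lemma hp_count (hG : IsPerfectRootedMary m r G ρ) (k : ℕ) : ∀ v, k ≤ G.dist ρ v →
    G.dist ρ v ≤ 2 * k →
    #{u | G.dist ρ u < G.dist ρ v ∧ G.dist u v = 2 * k + 1} + m ^ (2 * k - G.dist ρ v) = m ^ k := by
  have hT := hG.1
  have hzero : ∀ k v, k = G.dist ρ v →
      #{u | G.dist ρ u < G.dist ρ v ∧ G.dist u v = 2 * k + 1} = 0 := by
    intro k v hk
    rw [Finset.card_eq_zero, Finset.filter_eq_empty_iff]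
    rintro u - ⟨h1, h2⟩
    have := hT.connected.dist_triangle (u := u) (v := ρ) (w := v)
    rw [SimpleGraph.dist_comm (u := u) (v := ρ)] at this
    omega
  induction k with
  | zero =>
    intro v h1 h2
    rw [hzero 0 v (by omega)]
    simp
  | succ k ih =>
    intro v h1 h2
    rcases h1.eq_or_lt with h1 | h1
    · rw [hzero _ v h1, ← h1]
      rw [zero_add, show 2 * (k + 1) - (k + 1) = k + 1 by omega]
    · obtain ⟨ha, hb⟩ := hp_par_spec hT (ρ := ρ) (v := v) (by omega)
      set w := hpPar G ρ v with hw
      obtain ⟨hc, hd⟩ := hp_par_spec hT (ρ := ρ) (v := w) (by omega)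
      set x := hpPar G ρ w with hx
      have e1 := ih x (by omega) (by omega)
      have e2 := hp_same hG k w (by omega)
      rw [show 2 * (k + 1) - G.dist ρ v = 2 * k - G.dist ρ x by omega, ← e2, ← e1, ← add_assoc,
        ← Finset.card_union_of_disjoint]
      · congr 2
        ext u
        simp only [Finset.mem_union, Finset.mem_filter, Finset.mem_univ, true_and]
        have p1 := hp_parity hT ρ u w
        rw [Nat.even_iff] at p1
        have q1 : G.dist ρ u < G.dist ρ v → G.dist u v = G.dist u w + 1 := fun h =>
          (hp_dist_par hT (by rintro rfl; omega) h.le).2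
        have q2 : G.dist ρ u < G.dist ρ w → G.dist u w = G.dist u x + 1 := fun h =>
          (hp_dist_par hT (by rintro rfl; omega) h.le).2
        have p2 := hp_parity hT ρ u x
        rw [Nat.even_iff] at p2
        omega
      · rw [Finset.disjoint_left]
        intro u
        simp only [Finset.mem_filter, Finset.mem_univ, true_and]
        omega

lemma hp_sum (hG : IsPerfectRootedMary m r G ρ) (f : ℕ → ℚ) :
    ∑ v, f (G.dist ρ v) = ∑ e ∈ Finset.range (r + 1), (m : ℚ) ^ e * f e := by
  rw [← Finset.sum_fiberwise_of_maps_to (s := Finset.univ) (t := Finset.range (r + 1))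
    (g := fun v => G.dist ρ v)]
  · refine Finset.sum_congr rfl fun e he => ?_
    rw [Finset.sum_congr rfl (g := fun _ => f e), Finset.sum_const, nsmul_eq_mul, hp_level hG e]
    · push_cast; rfl
    · simp at he; omega
    · intro v hv
      simp at hv
      rw [hv]
  · intro v _
    have := hG.2.2.2.1 v
    simp; omega

lemma hp_card (hG : IsPerfectRootedMary m r G ρ) :
    (Fintype.card W : ℚ) = ∑ e ∈ Finset.range (r + 1), (m : ℚ) ^ e := by
  have := hp_sum hG (fun _ => 1)
  simpa using this

lemma hp_pathCount (hT : G.IsTree) (ρ : W) (k : ℕ) :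
    pathCount G (2 * k + 1) =
      ∑ v, #{u | G.dist ρ u < G.dist ρ v ∧ G.dist u v = 2 * k + 1} := by
  rw [← Finset.card_sigma]
  unfold pathCount
  symm
  refine Finset.card_bij (fun p _ => s(p.2, p.1)) ?_ ?_ ?_
  · rintro ⟨v, u⟩ h
    simp only [Finset.mem_sigma, Finset.mem_filter, Finset.mem_univ, true_and] at h ⊢
    exact ⟨u, v, rfl, h.2⟩
  · rintro ⟨v, u⟩ h ⟨v', u'⟩ h' he
    simp only [Finset.mem_sigma, Finset.mem_filter, Finset.mem_univ, true_and] at h h'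
    simp only [Sym2.eq_iff] at he
    rcases he with ⟨h1, h2⟩ | ⟨h1, h2⟩
    · subst h1 h2; rfl
    · subst h1 h2; omega
  · rintro p h
    simp only [Finset.mem_filter, Finset.mem_univ, true_and] at h
    obtain ⟨u, v, rfl, h⟩ := h
    have hp := hp_parity hT ρ u v
    rw [Nat.even_iff] at hp
    rcases lt_or_gt_of_ne (show G.dist ρ u ≠ G.dist ρ v by omega) with h1 | h1
    · exact ⟨⟨v, u⟩, by simp [h1, h], rfl⟩
    · exact ⟨⟨u, v⟩, by simp [h1, SimpleGraph.dist_comm, h], Sym2.eq_swap⟩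

/-- truncating a perfect tree at a smaller positive depth gives a perfect tree -/
lemma hp_trunc (hm : 2 ≤ m) (hG : IsPerfectRootedMary m r G ρ) {k : ℕ} (hk : 0 < k) (hkr : k < r) :
    ∃ (X : Type) (_ : Fintype X) (H : SimpleGraph X) (_ : DecidableRel H.Adj) (ρ' : X),
      IsPerfectRootedMary m k H ρ' := by
  classical
  obtain ⟨hT, hroot, hdeg, hmax, ⟨z, hz⟩, hleaf⟩ := id hG
  let s : Set W := {v | G.dist ρ v ≤ k}
  let H : SimpleGraph s := G.induce s
  let ρ' : s := ⟨ρ, by simp [s]⟩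
  have hwalk : ∀ n, ∀ v : s, G.dist ρ v = n → ∃ p : H.Walk ρ' v, p.length = n := by
    intro n
    induction n with
    | zero =>
      rintro ⟨v, hv⟩ h
      have : ρ = v := (hT.connected.dist_eq_zero_iff).1 h
      subst this
      exact ⟨SimpleGraph.Walk.nil, rfl⟩
    | succ n ih =>
      rintro ⟨v, hv⟩ h
      simp only at h
      obtain ⟨ha, hb⟩ := hp_par_spec hT (ρ := ρ) (v := v) (by omega)
      have hv' : G.dist ρ v ≤ k := hv
      obtain ⟨p, hp⟩ := ih ⟨hpPar G ρ v, show G.dist ρ _ ≤ k by omega⟩ (by simp only; omega)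
      refine ⟨p.concat (show H.Adj _ _ from ha.symm), ?_⟩
      rw [SimpleGraph.Walk.length_concat, hp]
  have hconn : H.Connected := by
    rw [SimpleGraph.connected_iff_exists_forall_reachable]
    exact ⟨ρ', fun v => (hwalk _ v rfl).choose.reachable⟩
  have hHT : H.IsTree := ⟨hconn, hT.isAcyclic.induce s⟩
  have hdist : ∀ v : s, H.dist ρ' v = G.dist ρ v := by
    intro v
    apply le_antisymm
    · obtain ⟨p, hp⟩ := hwalk _ v rfl
      rw [← hp]; exact SimpleGraph.dist_le p
    · obtain ⟨p, hp⟩ := hconn.exists_walk_length_eq_dist ρ' v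
      rw [← hp]
      have := SimpleGraph.dist_le (p.map (SimpleGraph.Embedding.induce s).toHom)
      rw [SimpleGraph.Walk.length_map] at this
      exact this
  have hdegH : ∀ v : s, H.degree v = #((G.neighborFinset v).filter (fun u => G.dist ρ u ≤ k)) := by
    intro v
    rw [← SimpleGraph.card_neighborFinset_eq_degree]
    refine Finset.card_bij (fun u _ => (u : W)) ?_ ?_ ?_
    · intro u hu
      rw [SimpleGraph.mem_neighborFinset] at hu
      simp only [Finset.mem_filter, SimpleGraph.mem_neighborFinset]
      exact ⟨hu, u.2⟩
    · intro a _ b _ h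
      exact Subtype.ext h
    · intro b hb
      simp only [Finset.mem_filter, SimpleGraph.mem_neighborFinset] at hb
      exact ⟨⟨b, hb.2⟩, by rw [SimpleGraph.mem_neighborFinset]; exact hb.1, rfl⟩
  have hdeg1 : ∀ v : s, G.dist ρ v < k → H.degree v = G.degree v := by
    intro v hv
    rw [hdegH, Finset.filter_true_of_mem, SimpleGraph.card_neighborFinset_eq_degree]
    intro u hu
    rw [SimpleGraph.mem_neighborFinset] at hu
    have := hT.dist_eq_dist_add_one_of_adj ρ hu
    omega
  have hdeg2 : ∀ v : s, G.dist ρ v = k → H.degree v = 1 := by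
    intro v hv
    obtain ⟨ha, hb⟩ := hp_par_spec hT (ρ := ρ) (v := (v : W)) (by omega)
    rw [hdegH, Finset.card_eq_one]
    refine ⟨hpPar G ρ v, ?_⟩
    ext u
    simp only [Finset.mem_filter, SimpleGraph.mem_neighborFinset, Finset.mem_singleton]
    constructor
    · rintro ⟨h1, h2⟩
      have := hT.dist_eq_dist_add_one_of_adj ρ h1
      exact (hp_par_eq hT h1 (by omega)).symm
    · rintro rfl
      exact ⟨ha, by omega⟩
  have hρ0 : G.dist ρ (ρ' : W) = 0 := by simp [ρ']
  refine ⟨s, inferInstance, H, inferInstance, ρ', hHT, ?_, ?_, ?_, ?_, ?_⟩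
  · intro _
    rw [hdeg1 ρ' (by omega)]
    exact hroot (by omega)
  · intro v hv
    have hvs : G.dist ρ v ≤ k := v.2
    rcases hvs.eq_or_lt with h | h
    · left; exact hdeg2 v h
    · rw [hdeg1 v h]
      exact hdeg v (fun h => hv (Subtype.ext h))
  · intro v
    rw [hdist]; exact v.2
  · have : 0 < #{u | G.dist ρ u = k} := by
      rw [hp_level hG k hkr.le]; positivity
    obtain ⟨v, hv⟩ := Finset.card_pos.1 this
    simp at hv
    exact ⟨⟨v, hv.le⟩, by rw [hdist]; exact hv⟩
  · intro v hv
    rw [hdist]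
    have hvs : G.dist ρ v ≤ k := v.2
    rcases hvs.eq_or_lt with h | h
    · exact h
    · rw [hdeg1 v h] at hv
      have := hleaf v hv
      omega

end Helpers

theorem rooted_path_count_odd_large (m r : ℕ) (hm : 2 ≤ m)
    {W : Type} [Fintype W] [DecidableEq W] (G : SimpleGraph W) [DecidableRel G.Adj]
    (ρ : W) (hG : IsPerfectRootedMary m r G ρ)
    (VR : ℕ → ℚ)
    (hVR : ∀ (d : ℕ) (X : Type) [Fintype X] (H : SimpleGraph X) [DecidableRel H.Adj]
      (ρ' : X), IsPerfectRootedMary m d H ρ' → (Fintype.card X : ℚ) = VR d)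
    (t : ℕ) (ht : Odd t) (htr : r < t) (ht2r : t ≤ 2 * r) :
    (pathCount G t : ℚ) =
      (m : ℚ) ^ ((t - 1) / 2) * (VR r - VR ((t - 1) / 2)) -
        ((r : ℚ) - (((t - 1) / 2 : ℕ) : ℚ)) * (m : ℚ) ^ (t - 1) := by
  classical
  obtain ⟨k, rfl⟩ := ht
  rw [show (2 * k + 1 - 1) / 2 = k by omega, show 2 * k + 1 - 1 = 2 * k by omega]
  have hk : 0 < k := by omega
  have hkr : k < r := by omega
  have hVr : VR r = ∑ e ∈ Finset.range (r + 1), (m : ℚ) ^ e := by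
    rw [← hVR r W G ρ hG, hp_card hG]
  have hVk : VR k = ∑ e ∈ Finset.range (k + 1), (m : ℚ) ^ e := by
    obtain ⟨X, _, H, _, ρ', hH⟩ := hp_trunc hm hG hk hkr
    rw [← hVR k X H ρ' hH, hp_card hH]
  have hcount : ∀ v : W, ((#{u | G.dist ρ u < G.dist ρ v ∧ G.dist u v = 2 * k + 1} : ℕ) : ℚ)
      = (fun e => if k < e then (m : ℚ) ^ k - (m : ℚ) ^ (2 * k - e) else 0) (G.dist ρ v) := by
    intro v
    have hv := hG.2.2.2.1 v
    simp only
    split_ifs with h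
    · have := hp_count hG k v h.le (by omega)
      rw [eq_sub_iff_add_eq]
      exact_mod_cast this
    · rw [Nat.cast_eq_zero, Finset.card_eq_zero, Finset.filter_eq_empty_iff]
      rintro u - ⟨h1, h2⟩
      have := hG.1.connected.dist_triangle (u := u) (v := ρ) (w := v)
      rw [SimpleGraph.dist_comm (u := u) (v := ρ)] at this
      omega
  rw [hp_pathCount hG.1 ρ k, Nat.cast_sum, Finset.sum_congr rfl (fun v _ => hcount v),
    hp_sum hG (fun e => if k < e then (m : ℚ) ^ k - (m : ℚ) ^ (2 * k - e) else 0), hVr, hVk, ← Finset.sum_range_add_sum_Ico _ (show k + 1 ≤ r + 1 by omega),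
    ← Finset.sum_range_add_sum_Ico (fun e => (m : ℚ) ^ e) (show k + 1 ≤ r + 1 by omega)]
  rw [Finset.sum_eq_zero, zero_add, add_sub_cancel_left, Finset.mul_sum]
  · rw [Finset.sum_congr rfl (g := fun e => (m : ℚ) ^ k * (m : ℚ) ^ e - (m : ℚ) ^ (2 * k)),
      Finset.sum_sub_distrib, Finset.sum_const, Nat.card_Ico, nsmul_eq_mul]
    · rw [show r + 1 - (k + 1) = r - k by omega, Nat.cast_sub hkr.le]
    · intro e he
      rw [Finset.mem_Ico] at he
      rw [if_pos (by omega), mul_sub, ← pow_add, ← pow_add, ← pow_add, add_comm e k,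
        show e + (2 * k - e) = 2 * k by omega]
  · intro e he
    rw [Finset.mem_range] at he
    rw [if_neg (by omega), mul_zero]
end

section
/- Let m ≥ 2 and let T be the perfect rooted m-ary tree of depth r. If t is even and r < t ≤ 2r, then the number of paths of length t in T equals (1/2)(m+1) · m^(t/2 − 1) · (V_R(r) − V_R(t/2 − 1)) − (r − t/2 + 1) · m^(t−1), where V_R(d) is the number of vertices in the perfect rooted m-ary tree of depth d. -/
open SimpleGraph Finset

/-! Helper facts on trees. -/

lemma tree_step {W : Type} {G : SimpleGraph W} (hG : G.IsTree) (x : W) {u w : W}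
    (h : G.Adj u w) : G.dist u x = G.dist w x + 1 ∨ G.dist w x = G.dist u x + 1 := by
  have := hG.dist_eq_dist_add_one_of_adj x h
  rwa [G.dist_comm (u := x) (v := u), G.dist_comm (u := x) (v := w)] at this

lemma tree_next {W : Type} {G : SimpleGraph W} (hG : G.IsTree) {u x : W} {k : ℕ}
    (h : G.dist u x = k + 1) : ∃ w, G.Adj u w ∧ G.dist w x = k := by
  obtain ⟨p, hp⟩ := hG.connected.exists_walk_length_eq_dist u x
  cases p with
  | nil => simp at h
  | cons hadj q =>
    rename_i w
    refine ⟨w, hadj, ?_⟩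
    have h1 := dist_le q
    have h2 := tree_step hG x hadj
    simp only [Walk.length_cons] at hp
    omega

lemma tree_next_unique {W : Type} {G : SimpleGraph W} (hG : G.IsTree) {u x w w' : W}
    (h : G.Adj u w) (h' : G.Adj u w') (hd : G.dist u x = G.dist w x + 1)
    (hd' : G.dist u x = G.dist w' x + 1) : w = w' := by
  obtain ⟨p, hp⟩ := hG.connected.exists_walk_length_eq_dist w x
  obtain ⟨q, hq⟩ := hG.connected.exists_walk_length_eq_dist w' x
  have h1 : (Walk.cons h p).IsPath := Walk.isPath_of_length_eq_dist _ (by simp [hp, hd])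
  have h2 : (Walk.cons h' q).IsPath := Walk.isPath_of_length_eq_dist _ (by simp [hq, hd'])
  have h3 := (hG.existsUnique_path u x).unique h1 h2
  have h4 := congrArg Walk.snd h3
  simpa using h4

/-- If `p` is the parent of `u`, the vertices closer to `u` than to `p` are the descendants. -/
lemma tree_desc {W : Type} {G : SimpleGraph W} (hG : G.IsTree) (ρ : W) (k : ℕ) :
    ∀ {p u v : W}, G.Adj u p → G.dist u ρ = G.dist p ρ + 1 → G.dist u v = k →
      G.dist p v = k + 1 → G.dist v ρ = G.dist u ρ + k := by
  induction k with
  | zero =>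
    intro p u v _ _ h0 _
    have := hG.connected.dist_eq_zero_iff.1 h0
    subst this; simp
  | succ k ih =>
    intro p u v hup hl h1 h2
    obtain ⟨w, huw, hw⟩ := tree_next hG h1
    have hne : w ≠ p := by rintro rfl; omega
    have hlw : G.dist w ρ = G.dist u ρ + 1 := by
      rcases tree_step hG ρ huw with h | h
      · exact absurd (tree_next_unique hG huw hup h hl) hne
      · exact h
    have := ih huw.symm hlw hw h1
    omega

lemma tree_desc_iff {W : Type} {G : SimpleGraph W} (hG : G.IsTree) (ρ : W) 
    {p u v : W} (hup : G.Adj u p) (hl : G.dist u ρ = G.dist p ρ + 1) :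
      G.dist p v = G.dist u v + 1 ↔ G.dist v ρ = G.dist u ρ + G.dist u v := by
  constructor
  · intro h
    exact tree_desc hG ρ _ hup hl rfl h
  · intro h
    rcases tree_step hG v hup with h' | h'
    · have := hG.connected.dist_triangle (u := v) (v := p) (w := ρ)
      rw [G.dist_comm (u := v) (v := p)] at this
      omega
    · exact h'

section counting

variable {W : Type} [Fintype W] [DecidableEq W] (G : SimpleGraph W) [DecidableRel G.Adj] (ρ : W)

/-- Children of `u`. -/
noncomputable def childSet (u : W) : Finset W := univ.filter fun w => G.Adj u w ∧ G.dist w ρ = G.dist u ρ + 1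

/-- Descendants of `u`, `k` levels below. -/
noncomputable def descSet (u : W) (k : ℕ) : Finset W :=
  univ.filter fun v => G.dist u v = k ∧ G.dist v ρ = G.dist u ρ + k

/-- Vertices at distance `k`. -/
noncomputable def sphereSet (u : W) (k : ℕ) : Finset W := univ.filter fun v => G.dist u v = k

variable {G ρ}

lemma card_childSet {m r : ℕ} (hm : 2 ≤ m) (hG : IsPerfectRootedMary m r G ρ) (u : W) :
    (childSet G ρ u).card = if G.dist u ρ < r then m else 0 := by
  obtain ⟨hT, hroot, hdeg, hle, -, hleaf⟩ := hG
  have hle' : ∀ v, G.dist v ρ ≤ r := fun v => G.dist_comm (u := v) ▸ hle v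
  have hleaf' : ∀ v, G.degree v = 1 → G.dist v ρ = r := fun v => G.dist_comm (u := v) ▸ hleaf v
  split_ifs with h
  · by_cases hu : u = ρ
    · subst hu
      rw [← hroot (by omega), ← G.card_neighborFinset_eq_degree]
      congr 1
      ext w
      simp only [childSet, mem_filter, mem_univ, true_and, mem_neighborFinset]
      refine ⟨fun h => h.1, fun h => ⟨h, ?_⟩⟩
      rcases tree_step hT u h with h' | h'
      · simp at h'
      · exact h'
    · have hd : G.degree u = m + 1 := by
        rcases hdeg u hu with h1 | h1
        · have := hleaf' u h1; omega
        · exact h1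
      have hpos := hT.connected.pos_dist_of_ne hu
      obtain ⟨p, hp, hpl⟩ := tree_next hT (u := u) (x := ρ) (k := G.dist u ρ - 1) (by omega)
      have : childSet G ρ u = (G.neighborFinset u).erase p := by
        ext w
        simp only [childSet, mem_filter, mem_univ, true_and, mem_neighborFinset, mem_erase]
        constructor
        · rintro ⟨h1, h2⟩
          refine ⟨?_, h1⟩
          rintro rfl; omega
        · rintro ⟨h1, h2⟩
          refine ⟨h2, ?_⟩
          rcases tree_step hT ρ h2 with h' | h'
          · exact absurd (tree_next_unique hT h2 hp h' (by omega)) h1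
          · exact h'
      rw [this, card_erase_of_mem (by simpa using hp), G.card_neighborFinset_eq_degree, hd]
      rfl
  · rw [card_eq_zero]
    ext w
    simp only [childSet, mem_filter, mem_univ, true_and, notMem_empty, iff_false]
    rintro ⟨-, h2⟩
    have := hle' w
    omega

lemma descSet_succ (hT : G.IsTree) (u : W) (k : ℕ) :
    descSet G ρ u (k + 1) = (childSet G ρ u).biUnion fun c => descSet G ρ c k := by
  ext v
  simp only [descSet, childSet, mem_filter, mem_univ, true_and, mem_biUnion]
  constructor
  · rintro ⟨h1, h2⟩
    obtain ⟨w, hw, hwv⟩ := tree_next hT h1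
    have h3 := hT.connected.dist_triangle (u := v) (v := w) (w := ρ)
    rw [G.dist_comm (u := v) (v := w)] at h3
    have := tree_step hT ρ hw
    exact ⟨w, ⟨hw, by omega⟩, hwv, by omega⟩
  · rintro ⟨c, ⟨h1, h2⟩, h3, h4⟩
    have h5 := hT.connected.dist_triangle (u := v) (v := u) (w := ρ)
    rw [G.dist_comm (u := v) (v := u)] at h5
    have := tree_step hT v h1
    omega

lemma card_descSet {m r : ℕ} (hm : 2 ≤ m) (hG : IsPerfectRootedMary m r G ρ) (k : ℕ) :
    ∀ u, (descSet G ρ u k).card = if G.dist u ρ + k ≤ r then m ^ k else 0 := by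
  have hT := hG.1
  have hle' : ∀ v, G.dist v ρ ≤ r := fun v => G.dist_comm (u := v) ▸ hG.2.2.2.1 v
  induction k with
  | zero =>
    intro u
    have : descSet G ρ u 0 = {u} := by
      ext v
      simp only [descSet, mem_filter, mem_univ, true_and, mem_singleton,
        hT.connected.dist_eq_zero_iff]
      constructor
      · rintro ⟨h, -⟩; exact h.symm
      · rintro rfl; simp
    rw [this]
    simp [hle' u]
  | succ k ih =>
    intro u
    rw [descSet_succ hT, card_biUnion]
    · have : ∀ c ∈ childSet G ρ u, (descSet G ρ c k).card
          = if G.dist u ρ + (k + 1) ≤ r then m ^ k else 0 := by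
        intro c hc
        simp only [childSet, mem_filter, mem_univ, true_and] at hc
        rw [ih c, hc.2, add_assoc, add_comm 1 k]
      rw [sum_congr rfl this, sum_const, card_childSet hm hG, smul_eq_mul]
      split_ifs
      · ring
      · simp
      · omega
      · simp
    · intro c hc c' hc' hne
      simp only [childSet, coe_filter, mem_univ, true_and, Set.mem_ofPred_eq] at hc hc'
      rw [Function.onFun, Finset.disjoint_left]
      intro v hv hv'
      simp only [descSet, mem_filter, mem_univ, true_and] at hv hv'
      apply hne
      have e (c : W) (hc : G.Adj u c ∧ G.dist c ρ = G.dist u ρ + 1)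
          (hv : G.dist c v = k ∧ G.dist v ρ = G.dist c ρ + k) : G.dist u v = G.dist c v + 1 := by
        have h5 := hT.connected.dist_triangle (u := v) (v := u) (w := ρ)
        rw [G.dist_comm (u := v) (v := u)] at h5
        have := tree_step hT v hc.1
        omega
      exact tree_next_unique hT hc.1 hc'.1 (e c hc hv) (e c' hc' hv')

lemma card_level {m r : ℕ} (hm : 2 ≤ m) (hG : IsPerfectRootedMary m r G ρ) (k : ℕ) (hk : k ≤ r) :
    (univ.filter fun v => G.dist v ρ = k).card = m ^ k := by
  have := card_descSet hm hG k ρ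
  simp only [dist_self, zero_add, hk, if_true] at this
  rw [← this]
  congr 1
  ext v
  simp [descSet, G.dist_comm (u := ρ) (v := v)]

lemma sum_by_level {m r : ℕ} (hm : 2 ≤ m) (hG : IsPerfectRootedMary m r G ρ) (f : ℕ → ℚ) :
    ∑ u : W, f (G.dist u ρ) = ∑ l ∈ range (r + 1), (m : ℚ) ^ l * f l := by
  have hle' : ∀ v, G.dist v ρ ≤ r := fun v => G.dist_comm (u := v) ▸ hG.2.2.2.1 v
  rw [← sum_fiberwise_of_maps_to (s := univ) (t := range (r + 1)) (g := fun v => G.dist v ρ)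
    (fun v _ => by have := hle' v; simp; omega)]
  refine sum_congr rfl fun l hl => ?_
  have hl' : l ≤ r := by simp at hl; omega
  have : ∀ v ∈ univ.filter (fun v => G.dist v ρ = l), f (G.dist v ρ) = f l := by
    intro v hv
    simp only [mem_filter, mem_univ, true_and] at hv
    rw [hv]
  rw [sum_congr rfl this, sum_const, card_level hm hG l hl']
  simp

lemma card_perfect {m r : ℕ} (hm : 2 ≤ m) (hG : IsPerfectRootedMary m r G ρ) :
    (Fintype.card W : ℚ) = ∑ l ∈ range (r + 1), (m : ℚ) ^ l := by
  have := sum_by_level hm hG (fun _ => 1)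
  simpa using this

lemma sphere_rec (hT : G.IsTree) {u p : W} (hup : G.Adj u p)
    (hl : G.dist u ρ = G.dist p ρ + 1) (k : ℕ) :
    (sphereSet G u (k + 2)).card + (descSet G ρ u k).card
      = (descSet G ρ u (k + 2)).card + (sphereSet G p (k + 1)).card := by
  have h1 : sphereSet G p (k + 1) =
      (univ.filter fun v => G.dist u v = k + 2 ∧ G.dist p v = k + 1) ∪ descSet G ρ u k := by
    ext v
    simp only [sphereSet, descSet, mem_filter, mem_univ, true_and, mem_union]
    have := tree_step hT v hup
    have := tree_desc_iff hT ρ (v := v) hup hl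
    omega
  have h2 : sphereSet G u (k + 2) =
      (univ.filter fun v => G.dist u v = k + 2 ∧ G.dist p v = k + 1) ∪ descSet G ρ u (k + 2) := by
    ext v
    simp only [sphereSet, descSet, mem_filter, mem_univ, true_and, mem_union]
    have := tree_step hT v hup
    have := tree_desc_iff hT ρ (v := v) hup hl
    omega
  rw [h1, h2, card_union_of_disjoint, card_union_of_disjoint]
  · omega
  · rw [Finset.disjoint_left]
    intro v hv hv'
    simp only [descSet, mem_filter, mem_univ, true_and] at hv hv'
    omega
  · rw [Finset.disjoint_left]
    intro v hv hv'
    simp only [descSet, mem_filter, mem_univ, true_and] at hv hv'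
    have := tree_desc_iff hT ρ (v := v) hup hl
    omega

lemma card_sphere {m r : ℕ} (hm : 2 ≤ m) (hG : IsPerfectRootedMary m r G ρ) (l : ℕ) :
    ∀ (u : W) (k : ℕ), G.dist u ρ = l → l < k →
    ((sphereSet G u k).card : ℚ) = (if l + k ≤ r then (m : ℚ) ^ k else 0) +
      ∑ j ∈ range l, (if k + 2 * j ≤ r + l then ((m : ℚ) - 1) * (m : ℚ) ^ (k + j - l - 1) else 0) := by
  have hT := hG.1
  induction l with
  | zero =>
    intro u k hu _
    have := hT.connected.dist_eq_zero_iff.1 hu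
    subst this
    have h := card_descSet hm hG k u
    have e : sphereSet G u k = descSet G u u k := by
      ext v
      simp [sphereSet, descSet, G.dist_comm (u := u) (v := v)]
    rw [e, h]
    simp
  | succ l ih =>
    intro u k hu hk
    obtain ⟨k, rfl⟩ : ∃ k', k = k' + 2 := ⟨k - 2, by omega⟩
    obtain ⟨p, hup, hp⟩ := tree_next hT hu
    have h1 := sphere_rec (ρ := ρ) hT hup (by omega) k
    have h2 := ih p (k + 1) hp (by omega)
    rw [card_descSet hm hG, card_descSet hm hG, hu] at h1
    have h1' := congrArg (Nat.cast : ℕ → ℚ) h1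
    push_cast at h1'
    rw [h2] at h1'
    rw [sum_range_succ]
    have e : ∀ j ∈ range l, (if k + 2 + 2 * j ≤ r + (l + 1) then
        ((m : ℚ) - 1) * (m : ℚ) ^ (k + 2 + j - (l + 1) - 1) else 0) =
        (if k + 1 + 2 * j ≤ r + l then
        ((m : ℚ) - 1) * (m : ℚ) ^ (k + 1 + j - l - 1) else 0) := by
      intro j _
      rw [show k + 2 + j - (l + 1) - 1 = k + 1 + j - l - 1 by omega]
      congr 1
      apply propext; omega
    rw [sum_congr rfl e, show k + 2 + l - (l + 1) - 1 = k by omega]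
    have c1 : (k + 2 + 2 * l ≤ r + (l + 1)) ↔ l + 1 + k ≤ r := by omega
    have c2 : (l + (k + 1) ≤ r) ↔ l + 1 + k ≤ r := by omega
    simp only [c1]
    simp only [c2] at h1'
    generalize (∑ j ∈ range l, (if k + 1 + 2 * j ≤ r + l then
        ((m : ℚ) - 1) * (m : ℚ) ^ (k + 1 + j - l - 1) else 0)) = Z at h1' ⊢
    split_ifs at h1' ⊢ <;> linear_combination h1'

lemma two_mul_pathCount (t : ℕ) (ht : 0 < t) :
    2 * pathCount G t = ∑ u : W, (sphereSet G u t).card := by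
  classical
  let H : SimpleGraph W :=
    { Adj := fun u v => G.dist u v = t
      symm := ⟨fun u v h => by rw [G.dist_comm]; exact h⟩
      loopless := ⟨fun u h => by simp at h; omega⟩ }
  have h := H.sum_degrees_eq_twice_card_edges
  have e1 : pathCount G t = H.edgeFinset.card := by
    unfold pathCount
    congr 1
    ext p
    induction p with
    | _ a b =>
      simp only [mem_filter, mem_univ, true_and, mem_edgeFinset, mem_edgeSet]
      constructor
      · rintro ⟨u, v, h1, h2⟩
        rcases Sym2.eq_iff.1 h1 with ⟨rfl, rfl⟩ | ⟨rfl, rfl⟩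
        · exact h2
        · exact G.dist_comm.trans h2
      · intro h
        exact ⟨a, b, rfl, h⟩
  rw [e1, ← h]
  refine sum_congr rfl fun u _ => ?_
  rw [← H.card_neighborFinset_eq_degree]
  congr 1
  ext v
  simp [sphereSet, H]

end counting

/-- The ball of radius `d` around the root is a perfect tree of depth `d`. -/
lemma perfect_truncate {m r d : ℕ} (hm : 2 ≤ m) {W : Type} [Fintype W] [DecidableEq W]
    (G : SimpleGraph W) [DecidableRel G.Adj] (ρ : W) (hG : IsPerfectRootedMary m r G ρ)
    (hd : d < r) : ∃ (X : Type) (_ : Fintype X) (_ : DecidableEq X) (H : SimpleGraph X)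
      (_ : DecidableRel H.Adj) (ρ' : X), IsPerfectRootedMary m d H ρ' := by
  classical
  have hT := hG.1
  let S : Set W := {v | G.dist v ρ ≤ d}
  let ρ' : S := ⟨ρ, by simp [S]⟩
  let H : SimpleGraph S := G.induce S
  have hw : ∀ k, ∀ v : S, G.dist v ρ = k → ∃ p : H.Walk v ρ', p.length = k := by
    intro k
    induction k with
    | zero =>
      intro v hv
      have := hT.connected.dist_eq_zero_iff.1 hv
      have : v = ρ' := Subtype.ext this
      subst this
      exact ⟨Walk.nil, rfl⟩
    | succ k ih =>
      intro v hv
      obtain ⟨w, h1, h2⟩ := tree_next hT hv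
      have hvS : G.dist v ρ ≤ d := v.2
      obtain ⟨p, hp⟩ := ih ⟨w, by simp only [S, Set.mem_ofPred_eq]; omega⟩ h2
      have hadj : H.Adj v ⟨w, by simp only [S, Set.mem_ofPred_eq]; omega⟩ := h1
      exact ⟨Walk.cons hadj p, by simp [hp]⟩
  have hconn : H.Connected := by
    have : Nonempty S := ⟨ρ'⟩
    refine ⟨fun u v => ?_⟩
    obtain ⟨p, -⟩ := hw _ u rfl
    obtain ⟨q, -⟩ := hw _ v rfl
    exact ⟨p.append q.reverse⟩
  have hHT : H.IsTree := ⟨hconn, hT.isAcyclic.induce S⟩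
  have hdist : ∀ v : S, H.dist ρ' v = G.dist v ρ := by
    intro v
    rw [H.dist_comm]
    apply le_antisymm
    · obtain ⟨p, hp⟩ := hw _ v rfl
      rw [← hp]; exact dist_le p
    · obtain ⟨p, hp⟩ := hconn.exists_walk_length_eq_dist v ρ'
      rw [← hp]
      have := dist_le (p.map (Embedding.induce S).toHom)
      rwa [Walk.length_map] at this
  have hcard : ∀ v : S, H.degree v = ((G.neighborFinset v).filter (· ∈ S)).card := by
    intro v
    rw [← H.card_neighborFinset_eq_degree, ← card_map (Function.Embedding.subtype _)]
    congr 1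
    ext w
    simp [H, S, and_comm]
  have hin : ∀ v : S, G.dist v ρ < d → H.degree v = G.degree v := by
    intro v hv
    rw [hcard, ← G.card_neighborFinset_eq_degree, filter_true_of_mem]
    intro w hw
    simp only [mem_neighborFinset] at hw
    have := tree_step hT ρ hw
    simp only [S, Set.mem_ofPred_eq]
    omega
  obtain ⟨-, hroot, hdeg, hle, ⟨x, hx⟩, hleaf⟩ := hG
  have hbd : ∀ v : S, G.dist v ρ = d → 0 < d → H.degree v = 1 := by
    intro v hv hd0
    obtain ⟨p, hp, hpl⟩ := tree_next hT (u := v) (x := ρ) (k := d - 1) (by omega)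
    rw [hcard, card_eq_one]
    refine ⟨p, ?_⟩
    ext w
    simp only [mem_filter, mem_neighborFinset, mem_singleton, S, Set.mem_ofPred_eq]
    constructor
    · rintro ⟨h1, h2⟩
      have := tree_step hT ρ h1
      exact tree_next_unique hT h1 hp (x := ρ) (by omega) (by omega)
    · rintro rfl
      exact ⟨hp, by omega⟩
  refine ⟨S, inferInstance, inferInstance, H, inferInstance, ρ', hHT, ?_, ?_, ?_, ?_, ?_⟩
  · intro h0
    rw [hin ρ' (by simpa [ρ'] using h0)]
    exact hroot (by omega)
  · intro v hv
    have hne : (v : W) ≠ ρ := fun h => hv (Subtype.ext h)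
    have hpos := hT.connected.pos_dist_of_ne hne
    have hvS : G.dist v ρ ≤ d := v.2
    rcases hvS.lt_or_eq with h | h
    · rw [hin v h]; exact hdeg v hne
    · exact Or.inl (hbd v h (by omega))
  · intro v
    rw [hdist]; exact v.2
  · have : ∀ k, ∀ v : W, G.dist v ρ = d + k → ∃ w : W, G.dist w ρ = d := by
      intro k
      induction k with
      | zero => intro v hv; exact ⟨v, hv⟩
      | succ k ih =>
        intro v hv
        obtain ⟨w, -, h2⟩ := tree_next hT hv
        exact ih w h2
    obtain ⟨w, hw⟩ := this (r - d) x (by rw [G.dist_comm, hx]; omega)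
    exact ⟨⟨w, hw.le⟩, by rw [hdist]; exact hw⟩
  · intro v hv
    rw [hdist]
    have hvS : G.dist v ρ ≤ d := v.2
    by_contra hne
    rw [hin v (by omega)] at hv
    have := hleaf v hv
    rw [G.dist_comm] at this
    omega

lemma arith_count (R A : ℕ) (c : ℚ) :
    ∑ a ∈ range R, (if A ≤ a then c else 0) = ((R - A : ℕ) : ℚ) * c := by
  rw [← sum_filter, sum_const, nsmul_eq_mul]
  congr 2
  rw [← Nat.card_Ico]
  congr 1
  ext a
  simp [and_comm]

lemma arith_geom (m : ℚ) (n : ℕ) :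
    (m - 1) * ∑ j ∈ range (n + 1), m ^ j * (2 * ((n : ℚ) - j) + 1)
      = (m + 1) * ∑ j ∈ range (n + 1), m ^ j - 2 * (n + 1) := by
  induction n with
  | zero => simp; ring
  | succ n ih =>
    rw [sum_range_succ, sum_range_succ _ (n + 1)]
    have e : ∑ j ∈ range (n + 1), m ^ j * (2 * (((n + 1 : ℕ) : ℚ) - j) + 1)
        = ∑ j ∈ range (n + 1), m ^ j * (2 * ((n : ℚ) - j) + 1)
          + 2 * ∑ j ∈ range (n + 1), m ^ j := by
      rw [mul_sum, ← sum_add_distrib]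
      refine sum_congr rfl fun j _ => ?_
      push_cast; ring
    have g := mul_geom_sum m (n + 1)
    rw [e]
    push_cast
    linear_combination ih + 2 * g

lemma arith_total (m : ℚ) (n s : ℕ) (hs : n < s) :
    ∑ l ∈ range (n + s + 1), m ^ l * ((if l + 2 * s ≤ n + s then m ^ (2 * s) else 0) +
      ∑ j ∈ range l, (if 2 * s + 2 * j ≤ n + s + l then (m - 1) * m ^ (2 * s + j - l - 1) else 0))
    = m ^ (2 * s - 1) * ((m + 1) * ∑ j ∈ range (n + 1), m ^ j - 2 * (n + 1)) := by
  let g : ℕ → ℕ → ℚ := fun j a => if s + j - n ≤ a then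
          (m - 1) * m ^ (2 * s - 1) * m ^ j else 0
  have h1 : ∀ l ∈ range (n + s + 1), m ^ l * ((if l + 2 * s ≤ n + s then m ^ (2 * s) else 0) +
      ∑ j ∈ range l, (if 2 * s + 2 * j ≤ n + s + l then (m - 1) * m ^ (2 * s + j - l - 1) else 0))
      = ∑ j ∈ range (l + 1), g j (l - j) := by
    intro l hl
    simp only [g]
    have hl : l < n + s + 1 := by simpa using hl
    rw [if_neg (by omega), zero_add, sum_range_succ, if_neg (by omega), add_zero, mul_sum]
    refine sum_congr rfl fun j hj => ?_
    have hj : j < l := by simpa using hj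
    have c : (2 * s + 2 * j ≤ n + s + l) ↔ s + j - n ≤ l - j := by omega
    simp only [c]
    split_ifs
    · have : m ^ l * m ^ (2 * s + j - l - 1) = m ^ (2 * s - 1) * m ^ j := by
        rw [← pow_add, ← pow_add]; congr 1; omega
      linear_combination (m - 1) * this
    · simp
  rw [sum_congr rfl h1, sum_range_diag_flip]
  simp only [g, arith_count]
  rw [show n + s + 1 = (n + 1) + s by omega, sum_range_add, ← arith_geom]
  have h2 : ∑ x ∈ range s, ((n + 1 + s - (n + 1 + x) - (s + (n + 1 + x) - n) : ℕ) : ℚ) *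
      ((m - 1) * m ^ (2 * s - 1) * m ^ (n + 1 + x)) = 0 := by
    refine sum_eq_zero fun x _ => ?_
    rw [show n + 1 + s - (n + 1 + x) - (s + (n + 1 + x) - n) = 0 by omega]
    simp
  rw [h2, add_zero, mul_sum, mul_sum]
  refine sum_congr rfl fun j hj => ?_
  have hj : j < n + 1 := by simpa using hj
  have e : ((n + 1 + s - j - (s + j - n) : ℕ) : ℚ) = 2 * ((n : ℚ) - j) + 1 := by
    have : ((n + 1 + s - j - (s + j - n) : ℕ) : ℚ) = ((2 * (n - j) + 1 : ℕ) : ℚ) := by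
      congr 1; omega
    rw [this]; push_cast [Nat.cast_sub (show j ≤ n by omega)]; ring
  rw [e]; ring

theorem rooted_path_count_even_large (m r : ℕ) (hm : 2 ≤ m)
    {W : Type} [Fintype W] [DecidableEq W] (G : SimpleGraph W) [DecidableRel G.Adj]
    (ρ : W) (hG : IsPerfectRootedMary m r G ρ)
    (VR : ℕ → ℚ)
    (hVR : ∀ (d : ℕ) (X : Type) [Fintype X] (H : SimpleGraph X) [DecidableRel H.Adj]
      (ρ' : X), IsPerfectRootedMary m d H ρ' → (Fintype.card X : ℚ) = VR d)
    (t : ℕ) (ht : Even t) (htr : r < t) (ht2r : t ≤ 2 * r) :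
    (pathCount G t : ℚ) =
      (1 / 2) * ((m : ℚ) + 1) * (m : ℚ) ^ (t / 2 - 1) * (VR r - VR (t / 2 - 1)) -
        ((r : ℚ) - ((t / 2 : ℕ) : ℚ) + 1) * (m : ℚ) ^ (t - 1) := by
  obtain ⟨s, hs⟩ := ht
  obtain rfl : t = 2 * s := by omega
  obtain ⟨n, rfl⟩ : ∃ n, r = n + s := ⟨r - s, by omega⟩
  have h2s : 2 * s / 2 = s := by omega
  rw [h2s]
  obtain ⟨X, i1, i2, H, i3, ρ', hH⟩ := perfect_truncate (d := s - 1) hm G ρ hG (by omega)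
  have v1 := hVR _ X H ρ' hH
  have v2 := hVR _ W G ρ hG
  rw [card_perfect hm hH] at v1
  rw [card_perfect hm hG] at v2
  have hp := two_mul_pathCount (G := G) (2 * s) (by omega)
  have hle' : ∀ v, G.dist v ρ ≤ n + s := fun v => G.dist_comm (u := v) ▸ hG.2.2.2.1 v
  have hp' := congrArg (Nat.cast : ℕ → ℚ) hp
  push_cast at hp'
  rw [sum_congr rfl (fun u _ => card_sphere hm hG (G.dist u ρ) u (2 * s) rfl
    (by have := hle' u; omega))] at hp'
  rw [sum_by_level hm hG (fun l => (if l + 2 * s ≤ n + s then (m : ℚ) ^ (2 * s) else 0) +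
      ∑ j ∈ range l, (if 2 * s + 2 * j ≤ n + s + l then
        ((m : ℚ) - 1) * (m : ℚ) ^ (2 * s + j - l - 1) else 0)),
    arith_total (m : ℚ) n s (by omega)] at hp'
  rw [← v1, ← v2]
  have e : ∑ l ∈ range (n + s + 1), (m : ℚ) ^ l - ∑ l ∈ range (s - 1 + 1), (m : ℚ) ^ l
      = (m : ℚ) ^ s * ∑ j ∈ range (n + 1), (m : ℚ) ^ j := by
    rw [show n + s + 1 = s + (n + 1) by omega, show s - 1 + 1 = s by omega, sum_range_add,
      mul_sum, add_sub_cancel_left]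
    exact sum_congr rfl fun j _ => pow_add _ _ _
  rw [e]
  have e2 : (m : ℚ) ^ (s - 1) * (m : ℚ) ^ s = (m : ℚ) ^ (2 * s - 1) := by
    rw [← pow_add]; congr 1; omega
  push_cast
  rw [← e2] at hp' ⊢
  linear_combination (1 / 2) * hp'
end

section
/- Let m ≥ 2 and let k, r be integers with 1 ≤ k ≤ r. Then the number of paths of length t = 2k in the perfect unrooted m-ary tree of diameter D = 2r equals (m^(2k−1)/(m−1)) · ( (1/2)(m+1)^2 · m^(r−k) − (m+1) ). -/
open SimpleGraph Finset

section Helpers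

variable {W : Type} [Fintype W] [DecidableEq W] {G : SimpleGraph W} [DecidableRel G.Adj]

lemma exists_closer (hT : G.IsTree) (u v : W) (n : ℕ) (h : G.dist u v = n + 1) :
    ∃ w, G.Adj w v ∧ G.dist u w = n := by
  obtain ⟨p, hp⟩ := hT.connected.exists_walk_length_eq_dist v u
  rw [dist_comm, h] at hp
  cases p with
  | nil => simp at hp
  | @cons _ w _ ha q =>
    refine ⟨w, ha.symm, ?_⟩
    have h1 := dist_le q
    have h2 := hT.dist_eq_dist_add_one_of_adj u ha
    rw [dist_comm] at h1
    simp at hp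
    omega

lemma closer_unique (hT : G.IsTree) (u v w w' : W) (h : G.Adj w v) (h' : G.Adj w' v)
    (hd : G.dist u v = G.dist u w + 1) (hd' : G.dist u v = G.dist u w' + 1) : w = w' := by
  obtain ⟨p, hp⟩ := hT.connected.exists_walk_length_eq_dist u w
  obtain ⟨q, hq⟩ := hT.connected.exists_walk_length_eq_dist u w'
  have h1 : (p.concat h).IsPath := Walk.isPath_of_length_eq_dist _ (by
    rw [Walk.length_concat]; omega)
  have h2 : (q.concat h').IsPath := Walk.isPath_of_length_eq_dist _ (by
    rw [Walk.length_concat]; omega)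
  have h3 : p.concat h = q.concat h' := (hT.existsUnique_path u v).unique h1 h2
  have h4 := congrArg Walk.penultimate h3
  simpa using h4

lemma dist_through (hT : G.IsTree) (c x y : W) (hxy : G.Adj x y)
    (hc : G.dist c y = G.dist c x + 1) (n : ℕ) :
    ∀ z, G.dist y z = n → G.dist x z = n + 1 → G.dist c z = G.dist c x + 1 + n := by
  induction n using Nat.strong_induction_on with
  | _ n ih =>
    intro z hz hz'
    rcases n with _ | n
    · have : y = z := (hT.connected.dist_eq_zero_iff).1 hz
      subst this; omega
    · obtain ⟨w, hw, hwd⟩ := exists_closer hT y z n hz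
      have hxw : G.dist x w = n + 1 := by
        have a1 := hT.dist_eq_dist_add_one_of_adj x hw
        have a2 := hT.connected.dist_triangle (u := x) (v := y) (w := w)
        have a3 := dist_eq_one_iff_adj.2 hxy
        omega
      have hcw := ih n (by omega) w hwd hxw
      rcases hT.dist_eq_dist_add_one_of_adj c hw with a | a
      · exfalso
        rcases n with _ | n
        · have : y = w := (hT.connected.dist_eq_zero_iff).1 hwd
          subst this
          have := closer_unique hT c y x z hxy hw.symm hc a
          subst this
          simp at hz'
        · obtain ⟨w2, hw2, hwd2⟩ := exists_closer hT y w n hwd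
          have hxw2 : G.dist x w2 = n + 1 := by
            have a1 := hT.dist_eq_dist_add_one_of_adj x hw2
            have a2 := hT.connected.dist_triangle (u := x) (v := y) (w := w2)
            have a3 := dist_eq_one_iff_adj.2 hxy
            omega
          have hcw2 := ih n (by omega) w2 hwd2 hxw2
          have := closer_unique hT c w w2 z hw2 hw.symm (by omega) a
          subst this
          omega
      · omega

lemma exists_at (hT : G.IsTree) (u v : W) (i n : ℕ) (h : G.dist u v = i + n) :
    ∃ w, G.dist u w = i ∧ G.dist w v = n := by
  induction n generalizing v with
  | zero => exact ⟨v, by simpa using h, by simp⟩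
  | succ n ih =>
    obtain ⟨w, hw, hd⟩ := exists_closer hT u v (i + n) (by omega)
    obtain ⟨x, h1, h2⟩ := ih w hd
    refine ⟨x, h1, ?_⟩
    have a1 := hT.connected.dist_triangle (u := u) (v := x) (w := v)
    have a2 := hT.connected.dist_triangle (u := x) (v := w) (w := v)
    have a3 := dist_eq_one_iff_adj.2 hw
    omega

lemma exists_center (hT : G.IsTree) (r : ℕ) (hr : 1 ≤ r) (hle : ∀ u v, G.dist u v ≤ 2 * r)
    (hex : ∃ u v, G.dist u v = 2 * r) :
    ∃ c x, G.dist c x = r ∧ ∀ v, G.dist c v ≤ r := by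
  obtain ⟨u, v, huv⟩ := hex
  obtain ⟨c, hu, hv⟩ := exists_at hT u v r r (by omega)
  refine ⟨c, v, hv, fun x => ?_⟩
  rcases Nat.eq_zero_or_pos (G.dist c x) with h0 | h0
  · omega
  obtain ⟨n, hn⟩ : ∃ n, G.dist x c = n + 1 := ⟨G.dist c x - 1, by rw [dist_comm]; omega⟩
  obtain ⟨y, hy, hyd⟩ := exists_closer hT x c n hn
  have b1 := hT.dist_eq_dist_add_one_of_adj u hy
  have b2 := hT.dist_eq_dist_add_one_of_adj v hy
  have b3 := hT.connected.dist_triangle (u := u) (v := y) (w := v)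
  have e1 : G.dist y v = G.dist v y := dist_comm
  have e2 : G.dist c v = G.dist v c := dist_comm
  have e3 : G.dist c x = G.dist x c := dist_comm
  have e4 : G.dist y x = G.dist x y := dist_comm
  by_cases h : G.dist u y = G.dist u c + 1
  · have := dist_through hT u c y hy.symm h n x (by omega) (by omega)
    have := hle u x
    omega
  · have := dist_through hT v c y hy.symm (by omega) n x (by omega) (by omega)
    have := hle v x
    omega

lemma forward_card (hT : G.IsTree) (u v : W) :
    #{w | G.Adj v w ∧ G.dist u w = G.dist u v + 1} + (if G.dist u v = 0 then 0 else 1)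
      = G.degree v := by
  have key : #{w | G.Adj v w ∧ G.dist u w + 1 = G.dist u v}
      = (if G.dist u v = 0 then 0 else 1) := by
    split_ifs with h
    · rw [Finset.card_eq_zero, Finset.filter_eq_empty_iff]
      intro w _ hw; omega
    · obtain ⟨n, hn⟩ := Nat.exists_eq_succ_of_ne_zero h
      obtain ⟨w, hw, hd⟩ := exists_closer hT u v n hn
      rw [Finset.card_eq_one]
      refine ⟨w, ?_⟩
      ext x
      simp only [Finset.mem_filter, Finset.mem_univ, true_and, Finset.mem_singleton]
      constructor
      · rintro ⟨h1, h2⟩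
        exact closer_unique hT u v x w h1.symm hw h2.symm (by omega)
      · rintro rfl
        exact ⟨hw.symm, by omega⟩
  rw [← key, ← card_neighborFinset_eq_degree, ← Finset.card_union_of_disjoint]
  · congr 1
    ext w
    simp only [Finset.mem_union, Finset.mem_filter, Finset.mem_univ, true_and, mem_neighborFinset]
    constructor
    · tauto
    · intro h
      have := hT.dist_eq_dist_add_one_of_adj u h
      rcases this with a | a
      · exact Or.inr ⟨h, a.symm⟩
      · exact Or.inl ⟨h, a⟩
  · rw [Finset.disjoint_filter]
    intro w _ h1 h2
    omega

lemma step_fixed (hT : G.IsTree) (c u : W) (t b m q : ℕ)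
    (hdeg : ∀ v, G.dist c v ≤ b → G.degree v = m + 1)
    (hq : q + (if t = 0 then 0 else 1) = m + 1)
    (hu : G.dist c u < b + 1 + t) :
    #{v | G.dist c v ≤ b + 1 ∧ G.dist u v = t + 1} =
      q * #{v | G.dist c v ≤ b ∧ G.dist u v = t} := by
  have := Finset.card_mul_eq_card_mul (fun v w => G.Adj v w)
    (s := {v | G.dist c v ≤ b ∧ G.dist u v = t})
    (t := {v | G.dist c v ≤ b + 1 ∧ G.dist u v = t + 1}) (m := q) (n := 1) ?_ ?_
  · rw [mul_one] at this
    rw [← this, mul_comm]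
  · intro v hv
    simp only [Finset.mem_filter, Finset.mem_univ, true_and] at hv
    have h1 := forward_card hT u v
    rw [hdeg v hv.1, hv.2] at h1
    have : #{w | G.Adj v w ∧ G.dist u w = t + 1} = q := by omega
    rw [← this]
    congr 1
    ext w
    simp only [Finset.bipartiteAbove, Finset.mem_filter, Finset.mem_univ, true_and]
    constructor
    · tauto
    · rintro ⟨h1, h2⟩
      have := hT.dist_eq_dist_add_one_of_adj c h1
      refine ⟨⟨by omega, h2⟩, h1⟩
  · intro w hw
    simp only [Finset.mem_filter, Finset.mem_univ, true_and] at hw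
    obtain ⟨v, hv, hd⟩ := exists_closer hT u w t hw.2
    rw [Finset.card_eq_one]
    refine ⟨v, ?_⟩
    ext x
    simp only [Finset.bipartiteBelow, Finset.mem_filter, Finset.mem_univ, true_and,
      Finset.mem_singleton]
    constructor
    · rintro ⟨⟨h1, h2⟩, h3⟩
      exact closer_unique hT u w x v h3 hv (by omega) (by omega)
    · rintro rfl
      refine ⟨⟨?_, hd⟩, hv⟩
      by_contra hcon
      have h1 := hT.dist_eq_dist_add_one_of_adj c hv
      have e1 : G.dist x u = G.dist u x := dist_comm
      have e2 : G.dist w u = G.dist u w := dist_comm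
      have := dist_through hT c w x hv.symm (by omega) t u (by omega) (by omega)
      omega

/-- Number of ordered pairs at distance `t` with depths at most `a`, `b`. -/
noncomputable def pairB (G : SimpleGraph W) (c : W) (t a b : ℕ) : ℕ :=
  ∑ u ∈ univ.filter (fun u => G.dist c u ≤ a), #{v | G.dist c v ≤ b ∧ G.dist u v = t}

lemma pairB_symm (c : W) (t a b : ℕ) : pairB G c t a b = pairB G c t b a := by
  have := Finset.sum_card_bipartiteAbove_eq_sum_card_bipartiteBelow
    (s := univ.filter (fun u => G.dist c u ≤ a)) (t := univ.filter (fun u => G.dist c u ≤ b))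
    (fun u v => G.dist u v = t)
  simp only [Finset.bipartiteAbove, Finset.bipartiteBelow, Finset.filter_filter] at this
  unfold pairB
  rw [this]
  refine Finset.sum_congr rfl fun v _ => ?_
  congr 1
  ext x
  simp [dist_comm]

lemma pairB_step (hT : G.IsTree) (c : W) (t a b m q : ℕ)
    (hdeg : ∀ v, G.dist c v ≤ b → G.degree v = m + 1)
    (hq : q + (if t = 0 then 0 else 1) = m + 1) (ha : a < b + 1 + t) :
    pairB G c (t + 1) a (b + 1) = q * pairB G c t a b := by
  unfold pairB
  rw [Finset.mul_sum]
  refine Finset.sum_congr rfl fun u hu => ?_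
  simp only [Finset.mem_filter, Finset.mem_univ, true_and] at hu
  exact step_fixed hT c u t b m q hdeg hq (by omega)

lemma sphere_card (hT : G.IsTree) (c : W) (m s : ℕ)
    (hdeg : ∀ v, G.dist c v ≤ s → G.degree v = m + 1) :
    #{v | G.dist c v = s + 1} = (m + 1) * m ^ s := by
  have key : ∀ t, #{v | G.dist c v ≤ t ∧ G.dist c v = t} = #{v | G.dist c v = t} := by
    intro t
    congr 1
    ext v
    simp only [Finset.mem_filter, Finset.mem_univ, true_and]
    omega
  induction s with
  | zero =>
    have := step_fixed hT c c 0 0 m (m + 1) hdeg (by simp) (by simp)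
    rw [key, key] at this
    rw [this]
    have : #{v | G.dist c v = 0} = 1 := by
      rw [Finset.card_eq_one]
      refine ⟨c, ?_⟩
      ext v
      simp [hT.connected.dist_eq_zero_iff, eq_comm]
    rw [this]; simp
  | succ s ih =>
    have := step_fixed hT c c (s + 1) (s + 1) m m hdeg (by simp) (by simp)
    rw [key, key, ih (fun v hv => hdeg v (by omega))] at this
    rw [this]; ring

lemma ball_card (hT : G.IsTree) (c : W) (m s : ℕ)
    (hdeg : ∀ v, G.dist c v < s → G.degree v = m + 1) :
    #{v | G.dist c v ≤ s} * ((m : ℚ) - 1) = (m + 1) * m ^ s - 2 := by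
  induction s with
  | zero =>
    have : #{v | G.dist c v ≤ 0} = 1 := by
      rw [Finset.card_eq_one]
      refine ⟨c, ?_⟩
      ext v
      simp [hT.connected.dist_eq_zero_iff, eq_comm]
    rw [this]; push_cast; ring
  | succ s ih =>
    have h1 := sphere_card hT c m s (fun v hv => hdeg v (by omega))
    have h2 : #{v | G.dist c v ≤ s + 1} = #{v | G.dist c v ≤ s} + #{v | G.dist c v = s + 1} := by
      rw [← Finset.card_union_of_disjoint]
      · congr 1
        ext v
        simp only [Finset.mem_union, Finset.mem_filter, Finset.mem_univ, true_and]
        omega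
      · rw [Finset.disjoint_filter]
        intro v _ h1 h2
        omega
    rw [h2, h1]
    push_cast
    rw [add_mul, ih (fun v hv => hdeg v (by omega))]
    ring

lemma pairB_zero (hT : G.IsTree) (c : W) (s : ℕ) :
    pairB G c 0 s s = #{v | G.dist c v ≤ s} := by
  unfold pairB
  rw [Finset.card_eq_sum_ones]
  refine Finset.sum_congr rfl fun u hu => ?_
  rw [Finset.card_eq_one]
  refine ⟨u, ?_⟩
  ext v
  simp only [Finset.mem_filter, Finset.mem_univ, true_and, Finset.mem_singleton] at hu ⊢
  rw [hT.connected.dist_eq_zero_iff]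
  constructor
  · exact fun h => h.2.symm
  · rintro rfl
    exact ⟨hu, rfl⟩

lemma pairB_even (hT : G.IsTree) (c : W) (m s k : ℕ)
    (hdeg : ∀ v, G.dist c v < s + (k + 1) → G.degree v = m + 1) :
    pairB G c (2 * (k + 1)) (s + (k + 1)) (s + (k + 1)) =
      (m + 1) * m ^ (2 * k + 1) * #{v | G.dist c v ≤ s} := by
  induction k with
  | zero =>
    have h1 := pairB_step hT c 0 s s m (m + 1) (fun v hv => hdeg v (by omega)) (by simp) (by omega)
    have h2 := pairB_step hT c 1 (s + 1) s m m (fun v hv => hdeg v (by omega)) (by simp) (by omega)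
    rw [pairB_symm c 1] at h2
    simp only [zero_add] at h1
    rw [h1, pairB_zero hT] at h2
    rw [show 2 * (0 + 1) = 1 + 1 by rfl, zero_add, h2]
    ring
  | succ k ih =>
    have h0 := ih (fun v hv => hdeg v (by omega))
    have h1 := pairB_step hT c (2 * (k + 1)) (s + (k + 1)) (s + (k + 1)) m m
      (fun v hv => hdeg v (by omega)) (by simp) (by omega)
    have h2 := pairB_step hT c (2 * (k + 1) + 1) (s + (k + 1) + 1) (s + (k + 1)) m m
      (fun v hv => hdeg v (by omega)) (by simp) (by omega)
    rw [pairB_symm c (2 * (k + 1) + 1), h1, h0] at h2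
    rw [show 2 * (k + 1 + 1) = 2 * (k + 1) + 1 + 1 by ring,
      show s + (k + 1 + 1) = s + (k + 1) + 1 by ring, h2]
    ring

/-- The graph joining vertices at distance `t`. -/
def distGraph (G : SimpleGraph W) (t : ℕ) (ht : 0 < t) : SimpleGraph W where
  Adj u v := G.dist u v = t
  symm := ⟨fun u v h => by rw [dist_comm]; exact h⟩
  loopless := ⟨fun u h => by simp at h; omega⟩

lemma pathCount_two (G : SimpleGraph W) (t : ℕ) (ht : 0 < t) :
    2 * pathCount G t = ∑ u, #{v | G.dist u v = t} := by
  classical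
  have h := (distGraph G t ht).sum_degrees_eq_twice_card_edges
  have h1 : pathCount G t = #(distGraph G t ht).edgeFinset := by
    unfold pathCount
    congr 1
    ext p
    induction p using Sym2.ind with
    | _ x y =>
      simp only [Finset.mem_filter, Finset.mem_univ, true_and, mem_edgeFinset, mem_edgeSet]
      constructor
      · rintro ⟨u, v, h1, h2⟩
        rcases Sym2.eq_iff.1 h1 with ⟨rfl, rfl⟩ | ⟨rfl, rfl⟩
        · exact h2
        · exact dist_comm.trans h2
      · intro h
        exact ⟨x, y, rfl, h⟩
  rw [h1, ← h]
  refine Finset.sum_congr rfl fun u _ => ?_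
  rw [← card_neighborFinset_eq_degree]
  congr 1
  ext v
  rw [mem_neighborFinset, Finset.mem_filter]
  exact ⟨fun h => ⟨Finset.mem_univ _, h⟩, fun h => h.2⟩

end Helpers

theorem unrooted_evenD_even_paths (m k r : ℕ) (hm : 2 ≤ m)
    (hk : 1 ≤ k) (hkr : k ≤ r)
    {W : Type} [Fintype W] [DecidableEq W] (G : SimpleGraph W) [DecidableRel G.Adj]
    (hG : IsPerfectUnrootedMary m (2 * r) G) :
    (pathCount G (2 * k) : ℚ) =
      (m : ℚ) ^ (2 * k - 1) / ((m : ℚ) - 1) *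
        ((1 / 2) * ((m : ℚ) + 1) ^ 2 * (m : ℚ) ^ (r - k) - ((m : ℚ) + 1)) := by
  obtain ⟨hT, hdeg, hle, hex, hleaf⟩ := hG
  obtain ⟨c, _, _, hc⟩ := exists_center hT r (by omega) hle hex
  have hd : ∀ v, G.dist c v < r → G.degree v = m + 1 := by
    intro v hv
    rcases hdeg (by omega) v with h | h
    · obtain ⟨u, hu⟩ := hleaf v h
      have h1 := hT.connected.dist_triangle (u := u) (v := c) (w := v)
      have h2 := hc u
      rw [dist_comm] at h2
      omega
    · exact h
  obtain ⟨k, rfl⟩ : ∃ j, k = j + 1 := ⟨k - 1, by omega⟩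
  obtain ⟨s, rfl⟩ : ∃ s, r = s + (k + 1) := ⟨r - (k + 1), by omega⟩
  have h1 := pairB_even hT c m s k hd
  have h2 := ball_card hT c m s (fun v hv => hd v (by omega))
  have h3 := pathCount_two G (2 * (k + 1)) (by omega)
  have h4 : pairB G c (2 * (k + 1)) (s + (k + 1)) (s + (k + 1)) =
      ∑ u, #{v | G.dist u v = 2 * (k + 1)} := by
    unfold pairB
    simp [hc]
  rw [← h4, h1] at h3
  have h5 : (2 : ℚ) * pathCount G (2 * (k + 1)) =
      (m + 1) * m ^ (2 * k + 1) * #{v | G.dist c v ≤ s} := by exact_mod_cast h3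
  have hm' : (m : ℚ) - 1 ≠ 0 := by
    have : (2 : ℚ) ≤ m := by exact_mod_cast hm
    intro h
    linarith
  rw [show 2 * (k + 1) - 1 = 2 * k + 1 by omega, show s + (k + 1) - (k + 1) = s by omega]
  rw [div_mul_eq_mul_div, eq_div_iff hm']
  linear_combination ((m : ℚ) - 1) / 2 * h5 + (m + 1) * (m : ℚ) ^ (2 * k + 1) / 2 * h2
end
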